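/- Let F be a free group, let w ∈ F be an element that is not a proper power (w ≠ vᵐ for all v ∈ F and m ≥ 2), and let n ≥ 2 be an integer. If the one-relator group F/⟪w⟫ is residually ℚ-solvable, then the one-relator group F/⟪wⁿ⟫ is residually solvable, i.e. the intersection of its derived series is trivial. -/

import Mathlib

def ratDerived (G : Type*) [Group G] : ℕ → Subgroup G
  | 0 => ⊤
  | i + 1 =>
      Subgroup.closure
        {g | g ∈ ratDerived G i ∧
          ∃ k : ℕ, 1 ≤ k ∧ g ^ k ∈ ⁅ratDerived G i, ratDerived G i⁆}

instance ratDerived_normal (G : Type*) [Group G] (i : ℕ) : (ratDerived G i).Normal := by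
  induction i with
  | zero =>
    show (⊤ : Subgroup G).Normal
    infer_instance
  | succ i ih =>
    haveI := ih
    constructor
    intro x hx g
    have himg : (fun y => g * y * g⁻¹) ''
        {y | y ∈ ratDerived G i ∧ ∃ k : ℕ, 1 ≤ k ∧ y ^ k ∈ ⁅ratDerived G i, ratDerived G i⁆} ⊆
        {y | y ∈ ratDerived G i ∧ ∃ k : ℕ, 1 ≤ k ∧ y ^ k ∈ ⁅ratDerived G i, ratDerived G i⁆} := by
      rintro _ ⟨y, ⟨hy, k, hk, hyk⟩, rfl⟩
      refine ⟨ih.conj_mem y hy g, k, hk, ?_⟩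
      rw [conj_pow]
      exact (Subgroup.commutator_normal _ _).conj_mem _ hyk g
    have hmap : (ratDerived G (i + 1)).map (MulAut.conj g).toMonoidHom ≤ ratDerived G (i + 1) := by
      show (Subgroup.closure _).map _ ≤ Subgroup.closure _
      rw [MonoidHom.map_closure]
      refine (Subgroup.closure_le _).2 (fun y hy => Subgroup.subset_closure (himg ?_))
      simpa using hy
    exact hmap ⟨x, hx, rfl⟩

def ratDerivedOmega (G : Type*) [Group G] : Subgroup G := ⨅ i, ratDerived G i

instance ratDerivedOmega_normal (G : Type*) [Group G] : (ratDerivedOmega G).Normal := by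
  constructor
  intro x hx g
  simp only [ratDerivedOmega, Subgroup.mem_iInf] at hx ⊢
  exact fun i => (ratDerived_normal G i).conj_mem x (hx i) g

def QSolvable (G : Type*) [Group G] : Prop := ∃ n : ℕ, ratDerived G n = ⊥

def ResiduallyQSolvable (G : Type*) [Group G] : Prop := ratDerivedOmega G = ⊥

theorem UniqueProds.of_ker {G H : Type*} [Group G] [Group H] (f : G →* H) [UniqueProds H]
    (hker : UniqueProds f.ker) : UniqueProds G where
  uniqueMul_of_nonempty {A B} hA hB := by
    classical
    obtain ⟨a', ha', b', hb', h⟩ :=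
      UniqueProds.uniqueMul_of_nonempty (hA.image f) (hB.image f)
    obtain ⟨a, ha, rfl⟩ := Finset.mem_image.mp ha'
    obtain ⟨b, hb, rfl⟩ := Finset.mem_image.mp hb'
    let φ : {x // x ∈ A.filter (f · = f a)} → f.ker := fun x =>
      ⟨a⁻¹ * x.1, by simp [MonoidHom.mem_ker, (Finset.mem_filter.mp x.2).2]⟩
    let ψ : {x // x ∈ B.filter (f · = f b)} → f.ker := fun x =>
      ⟨x.1 * b⁻¹, by simp [MonoidHom.mem_ker, (Finset.mem_filter.mp x.2).2]⟩
    obtain ⟨c, hc, d, hd, hcd⟩ := hker.uniqueMul_of_nonempty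
      (A := Finset.univ.image φ) (B := Finset.univ.image ψ)
      ⟨φ ⟨a, by simp [ha]⟩, by simp⟩ ⟨ψ ⟨b, by simp [hb]⟩, by simp⟩
    obtain ⟨⟨a₁, ha₁⟩, -, rfl⟩ := Finset.mem_image.mp hc
    obtain ⟨⟨b₁, hb₁⟩, -, rfl⟩ := Finset.mem_image.mp hd
    have ha₂ := Finset.mem_filter.mp ha₁
    have hb₂ := Finset.mem_filter.mp hb₁
    refine ⟨a₁, ha₂.1, b₁, hb₂.1, UniqueMul.of_image_filter (f : G →ₙ* H) ha₂.2 hb₂.2 h ?_⟩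
    intro x y hx hy hxy
    have := @hcd (φ ⟨x, hx⟩) (ψ ⟨y, hy⟩) (by simp) (by simp) (by
      apply Subtype.ext
      have : a⁻¹ * x * (y * b⁻¹) = a⁻¹ * a₁ * (b₁ * b⁻¹) := by
        rw [mul_assoc, ← mul_assoc x, hxy]; group
      simpa [φ, ψ] using this)
    simpa [φ, ψ] using this

theorem UniqueProds.of_isMulTorsionFree {G : Type*} [CommGroup G] [IsMulTorsionFree G] :
    UniqueProds G where
  uniqueMul_of_nonempty {A B} hA hB := by
    classical
    let K := Subgroup.closure ((A ∪ B : Finset G) : Set G)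
    have : AddGroup.FG (Additive K) := GroupFG.iff_add_fg.mp (Group.closure_finset_fg _)
    have : UniqueProds K := (inferInstance : UniqueProds (Multiplicative (Additive K)))
    have hA' : ∀ x ∈ A, x ∈ K := fun x hx => Subgroup.subset_closure (by simp [hx])
    have hB' : ∀ x ∈ B, x ∈ K := fun x hx => Subgroup.subset_closure (by simp [hx])
    obtain ⟨a, ha, b, hb, h⟩ := UniqueProds.uniqueMul_of_nonempty
      (A := A.preimage K.subtype K.subtype_injective.injOn)
      (B := B.preimage K.subtype K.subtype_injective.injOn)
      (by obtain ⟨x, hx⟩ := hA; exact ⟨⟨x, hA' x hx⟩, by simpa using hx⟩)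
      (by obtain ⟨x, hx⟩ := hB; exact ⟨⟨x, hB' x hx⟩, by simpa using hx⟩)
    refine ⟨a, by simpa using ha, b, by simpa using hb, ?_⟩
    intro x y hx hy hxy
    have := @h ⟨x, hA' x hx⟩ ⟨y, hB' y hy⟩ (by simpa using hx) (by simpa using hy)
      (Subtype.ext hxy)
    simpa [Subtype.ext_iff] using this

theorem exists_pow_mem_commutator_of_mem_ratDerived_succ {G : Type*} [Group G] {i : ℕ} {g : G}
    (hg : g ∈ ratDerived G (i + 1)) :
    g ∈ ratDerived G i ∧ ∃ k : ℕ, 1 ≤ k ∧ g ^ k ∈ ⁅ratDerived G i, ratDerived G i⁆ := by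
  refine Subgroup.closure_induction (fun _ h => h) ⟨one_mem _, 1, le_rfl, by simp⟩ ?_ ?_ hg
  · rintro x y - - ⟨hx, k, hk, hxk⟩ ⟨hy, l, hl, hyl⟩
    refine ⟨mul_mem hx hy, k * l, Nat.mul_pos hk hl, ?_⟩
    have hcomm : Commute (x : G ⧸ ⁅ratDerived G i, ratDerived G i⁆) y := by
      rw [commute_iff_eq, ← commutatorElement_eq_one_iff_mul_comm, ← QuotientGroup.mk'_apply,
        ← QuotientGroup.mk'_apply, ← map_commutatorElement, QuotientGroup.mk'_apply,
        QuotientGroup.eq_one_iff]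
      exact Subgroup.commutator_mem_commutator hx hy
    rw [← QuotientGroup.eq_one_iff] at hxk hyl ⊢
    rw [QuotientGroup.mk_pow] at hxk hyl ⊢
    rw [QuotientGroup.mk_mul, hcomm.mul_pow, pow_mul, hxk, mul_comm k l, pow_mul, hyl, one_pow,
      one_pow, one_mul]
  · rintro x - ⟨hx, k, hk, hxk⟩
    exact ⟨inv_mem hx, k, hk, by rw [inv_pow]; exact inv_mem hxk⟩

theorem mem_ratDerived_succ_of_pow_mem {G : Type*} [Group G] {i : ℕ} {g : G}
    (hg : g ∈ ratDerived G i) {k : ℕ} (hk : k ≠ 0) (h : g ^ k ∈ ratDerived G (i + 1)) :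
    g ∈ ratDerived G (i + 1) := by
  obtain ⟨-, l, hl, hkl⟩ := exists_pow_mem_commutator_of_mem_ratDerived_succ h
  exact Subgroup.subset_closure
    ⟨hg, k * l, Nat.mul_pos (Nat.pos_of_ne_zero hk) hl, by rwa [pow_mul]⟩

theorem commutator_ratDerived_le {G : Type*} [Group G] (i : ℕ) :
    ⁅ratDerived G i, ratDerived G i⁆ ≤ ratDerived G (i + 1) := by
  intro x hx
  exact Subgroup.subset_closure ⟨Subgroup.commutator_le_left _ _ hx, 1, le_rfl, by simpa using hx⟩

theorem ratDerived_succ_le {G : Type*} [Group G] (i : ℕ) :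
    ratDerived G (i + 1) ≤ ratDerived G i :=
  (Subgroup.closure_le _).2 fun _ hx => hx.1

theorem ratDerived_antitone (G : Type*) [Group G] : Antitone (ratDerived G) :=
  antitone_nat_of_succ_le ratDerived_succ_le

theorem uniqueProds_quotient_ratDerived (G : Type*) [Group G] (i : ℕ) :
    UniqueProds (G ⧸ ratDerived G i) := by
  induction i with
  | zero =>
    have : Subsingleton (G ⧸ ratDerived G 0) :=
      QuotientGroup.subsingleton_quotient_top
    constructor
    intro A B hA hB
    exact ⟨_, hA.choose_spec, _, hB.choose_spec, UniqueMul.of_subsingleton⟩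
  | succ i ih =>
    let f : G ⧸ ratDerived G (i + 1) →* G ⧸ ratDerived G i :=
      QuotientGroup.map _ _ (MonoidHom.id G) (ratDerived_succ_le i)
    refine UniqueProds.of_ker f ?_
    have hmem : ∀ x : G, (x : G ⧸ ratDerived G (i + 1)) ∈ f.ker → x ∈ ratDerived G i := by
      intro x hx
      exact (QuotientGroup.eq_one_iff _).mp hx
    let _ : CommGroup f.ker :=
      { mul_comm := by
          rintro ⟨a, ha⟩ ⟨b, hb⟩
          obtain ⟨a, rfl⟩ := QuotientGroup.mk_surjective a
          obtain ⟨b, rfl⟩ := QuotientGroup.mk_surjective b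
          apply Subtype.ext
          change (a : G ⧸ ratDerived G (i + 1)) * b = b * a
          rw [← commutatorElement_eq_one_iff_mul_comm, ← QuotientGroup.mk'_apply,
            ← QuotientGroup.mk'_apply, ← map_commutatorElement, QuotientGroup.mk'_apply,
            QuotientGroup.eq_one_iff]
          exact commutator_ratDerived_le i
            (Subgroup.commutator_mem_commutator (hmem _ ha) (hmem _ hb)) }
    have : IsMulTorsionFree f.ker := by
      constructor
      intro n hn a b hab
      rw [← div_eq_one]
      have hab' : (a / b) ^ n = 1 := by rw [div_pow, div_eq_one]; exact hab
      generalize a / b = c at hab' ⊢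
      obtain ⟨c, hc⟩ := c
      obtain ⟨c, rfl⟩ := QuotientGroup.mk_surjective c
      have hcn : ((c ^ n : G) : G ⧸ ratDerived G (i + 1)) = 1 := congrArg Subtype.val hab'
      apply Subtype.ext
      exact (QuotientGroup.eq_one_iff _).mpr (mem_ratDerived_succ_of_pow_mem (hmem _ hc) hn
        ((QuotientGroup.eq_one_iff _).mp hcn))
    exact UniqueProds.of_isMulTorsionFree

theorem exists_hom_of_exists_functional {T V : Type*} [Group T] [IsFreeGroup T] (r : V → T) {q : ℕ}
    [Fact q.Prime]
    (hr : ∀ z : V → ZMod q, ∃ f : T →* Multiplicative (ZMod q),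
      ∀ v, f (r v) = Multiplicative.ofAdd (z v))
    (P : Type*) [Group P] [Finite P] (hP : IsPGroup q P) (γ : V → P) :
    ∃ θ : T →* P, ∀ v, θ (r v) = γ v := by
  induction hn : Nat.card P using Nat.strong_induction_on generalizing P with
  | _ n ih =>
  rcases subsingleton_or_nontrivial P with hs | hs
  · exact ⟨1, fun v => Subsingleton.elim _ _⟩
  have := hP.center_nontrivial
  obtain ⟨⟨z, hz⟩, hzq⟩ : ∃ z : Subgroup.center P, orderOf z = q := by
    refine exists_prime_orderOf_dvd_card' q ?_
    obtain ⟨m, hm, h⟩ := (IsPGroup.nontrivial_iff_card (hP.to_subgroup (Subgroup.center P))).mp this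
    rw [h]
    exact dvd_pow_self q hm.ne'
  have hzq' : orderOf z = q := by rwa [← Subgroup.orderOf_mk]
  let Z := Subgroup.zpowers z
  have hZ : ∀ x ∈ Z, ∀ y, y * x = x * y := fun x hx =>
    Subgroup.mem_center_iff.mp ((Subgroup.zpowers_le.mpr hz) hx)
  have hZn : Z.Normal := ⟨fun x hx g => by rw [hZ x hx, mul_inv_cancel_right]; exact hx⟩
  let ζ : Multiplicative (ZMod q) →* P := AddMonoidHom.toMultiplicativeLeft
    (ZMod.lift q ⟨(zmultiplesHom (Additive P) (Additive.ofMul z)), by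
      rw [zmultiplesHom_apply, natCast_zsmul, ← ofMul_pow, ← hzq', pow_orderOf_eq_one, ofMul_one]⟩)
  have hζ : ∀ m : ℤ, ζ (Multiplicative.ofAdd (m : ZMod q)) = z ^ m := by
    intro m
    simp [ζ]
  have hζZ : ∀ x, ζ x ∈ Z := by
    intro x
    obtain ⟨m, hm⟩ := ZMod.intCast_surjective x.toAdd
    have := hζ m
    rw [hm, ofAdd_toAdd] at this
    rw [this]
    exact zpow_mem (Subgroup.mem_zpowers z) m
  have hcard : Nat.card (P ⧸ Z) < n := by
    rw [← hn, Subgroup.card_eq_card_quotient_mul_card_subgroup Z, Nat.card_zpowers, hzq']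
    exact lt_mul_of_one_lt_right Nat.card_pos (Fact.out : q.Prime).one_lt
  obtain ⟨θ₁, hθ₁⟩ := ih _ hcard (P ⧸ Z) (hP.to_quotient Z) (fun v => (γ v : P ⧸ Z)) rfl
  let θ₀ : T →* P := IsFreeGroup.lift fun x => (θ₁ (IsFreeGroup.of x)).out
  have hθ₀ : ∀ t, ((θ₀ t : P) : P ⧸ Z) = θ₁ t := by
    intro t
    have : (QuotientGroup.mk' Z).comp θ₀ = θ₁ := by
      apply IsFreeGroup.ext_hom
      intro a
      simp [θ₀]
    exact DFunLike.congr_fun this t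
  have hdiff : ∀ v, ∃ m : ℤ, z ^ m = (θ₀ (r v))⁻¹ * γ v := fun v => by
    rw [← Subgroup.mem_zpowers_iff, ← QuotientGroup.eq, hθ₀, hθ₁]
  choose m hm using hdiff
  obtain ⟨f, hf⟩ := hr fun v => (m v : ZMod q)
  refine ⟨⟨⟨fun t => θ₀ t * ζ (f t), by simp⟩, ?_⟩, ?_⟩
  · intro x y
    simp only [map_mul]
    rw [mul_assoc, mul_assoc, ← mul_assoc (θ₀ y), hZ _ (hζZ (f x)), mul_assoc]
  · intro v
    change θ₀ (r v) * ζ (f (r v)) = γ v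
    rw [hf, hζ, hm, mul_inv_cancel_left]

/-- The monoid of upper triangular matrices with unit diagonal. -/
def unitriangular (l : ℕ) (R : Type*) [CommRing R] : Submonoid (Matrix (Fin l) (Fin l) R) where
  carrier := {M | (∀ i j, j < i → M i j = 0) ∧ ∀ i, M i i = 1}
  one_mem' := ⟨fun _ _ h => Matrix.one_apply_ne h.ne', fun _ => Matrix.one_apply_eq _⟩
  mul_mem' := by
    rintro A B ⟨hA, hA'⟩ ⟨hB, hB'⟩
    refine ⟨fun i j hij => ?_, fun i => ?_⟩
    · rw [Matrix.mul_apply]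
      refine Finset.sum_eq_zero fun k _ => ?_
      rcases lt_or_ge k i with h | h
      · rw [hA _ _ h, zero_mul]
      · rw [hB _ _ (hij.trans_le h), mul_zero]
    · rw [Matrix.mul_apply, Finset.sum_eq_single i, hA', hB', one_mul]
      · intro k _ hk
        rcases lt_or_gt_of_ne hk with h | h
        · rw [hA _ _ h, zero_mul]
        · rw [hB _ _ h, mul_zero]
      · simp

theorem pow_prime_pow_eq_one_of_mem_unitriangular {l q : ℕ} [Fact q.Prime]
    {M : Matrix (Fin l) (Fin l) (ZMod q)} (hM : M ∈ unitriangular l (ZMod q)) : M ^ q ^ l = 1 := by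
  have key : ∀ k : ℕ, ∀ i j : Fin l, (j : ℕ) < i + k → ((M - 1) ^ k) i j = 0 := by
    intro k
    induction k with
    | zero => intro i j h; exact Matrix.one_apply_ne (by rintro rfl; simp at h)
    | succ k ih =>
      intro i j h
      rw [pow_succ, Matrix.mul_apply]
      refine Finset.sum_eq_zero fun m _ => ?_
      rcases lt_or_ge (m : ℕ) (i + k) with hm | hm
      · rw [ih _ _ hm, zero_mul]
      · have hjm : j ≤ m := by rw [Fin.le_def]; omega
        rcases hjm.eq_or_lt with rfl | hlt
        · simp [hM.2]
        · simp [hM.1 _ _ hlt, Matrix.one_apply_ne hlt.ne']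
  have hnil : (M - 1) ^ q ^ l = 0 := by
    ext i j
    refine key _ i j ?_
    have := Nat.lt_pow_self (Fact.out : q.Prime).one_lt (n := l)
    omega
  rcases isEmpty_or_nonempty (Fin l) with h | h
  · exact Subsingleton.elim _ _
  have : CharP (Matrix (Fin l) (Fin l) (ZMod q)) q := inferInstance
  have h2 := add_pow_char_pow_of_commute (p := q) (n := l) (Commute.one_right (M - 1))
  rwa [sub_add_cancel, hnil, one_pow, zero_add] at h2

instance unitriangularGroup (l q : ℕ) [Fact q.Prime] : Group (unitriangular l (ZMod q)) where
  inv M := M ^ (q ^ l - 1)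
  inv_mul_cancel M := by
    change M ^ (q ^ l - 1) * M = 1
    rw [← pow_succ, Nat.sub_add_cancel (Nat.one_le_pow _ _ (Fact.out : q.Prime).pos)]
    exact Subtype.ext (pow_prime_pow_eq_one_of_mem_unitriangular M.2)

theorem isPGroup_unitriangular (l q : ℕ) [Fact q.Prime] : IsPGroup q (unitriangular l (ZMod q)) :=
  fun M => ⟨l, Subtype.ext (pow_prime_pow_eq_one_of_mem_unitriangular M.2)⟩

theorem exists_isPGroup_prod_ne_one (q : ℕ) [Fact q.Prime] {U : Type*} (l : ℕ) (hl : l ≠ 0)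
    (u : ℕ → U) (hu : ∀ i, i + 1 < l → u i ≠ u (i + 1)) (e : ℕ → ℕ) (he : ∀ i < l, ¬ q ∣ e i) :
    ∃ (P : Type) (_ : Group P) (_ : Finite P) (γ : U → P), IsPGroup q P ∧ (∀ x, γ x ^ q = 1) ∧
      ((List.range l).map fun i => γ (u i) ^ e i).prod ≠ 1 := by
  classical
  let N : U → Matrix (Fin (l + 1)) (Fin (l + 1)) (ZMod q) := fun x =>
    Matrix.of fun a b => if (b : ℕ) = a + 1 ∧ u a = x then 1 else 0
  have hN : ∀ x a b, N x a b = if (b : ℕ) = a + 1 ∧ u a = x then 1 else 0 := fun _ _ _ => rfl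
  have hN2 : ∀ x, N x * N x = 0 := by
    intro x
    ext a b
    rw [Matrix.mul_apply]
    refine Finset.sum_eq_zero fun c _ => ?_
    rw [hN, hN]
    split_ifs with h1 h2
    · exfalso
      have hb := b.2
      refine hu a (by omega) ?_
      rw [← h1.1, h1.2, h2.2]
    all_goals simp
  have hmem : ∀ x, 1 + N x ∈ unitriangular (l + 1) (ZMod q) := by
    intro x
    refine ⟨fun i j hij => ?_, fun i => ?_⟩
    · rw [Matrix.add_apply, Matrix.one_apply_ne hij.ne', hN, if_neg, add_zero]
      rw [Fin.lt_def] at hij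
      omega
    · rw [Matrix.add_apply, Matrix.one_apply_eq, hN, if_neg (by omega), add_zero]
  have hpow : ∀ x (k : ℕ), (1 + N x) ^ k = 1 + (k : ZMod q) • N x := by
    intro x k
    induction k with
    | zero => simp
    | succ k ih =>
      rw [pow_succ, ih, mul_add, mul_one, add_mul, one_mul, smul_mul_assoc, hN2, Nat.cast_succ, add_smul]
      rw [smul_zero, add_zero, one_smul, add_assoc]
  let γ : U → unitriangular (l + 1) (ZMod q) := fun x => ⟨1 + N x, hmem x⟩
  refine ⟨_, unitriangularGroup (l + 1) q, inferInstance, γ, isPGroup_unitriangular _ _,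
    fun x => ?_, fun h => ?_⟩
  · apply Subtype.ext
    change (1 + N x) ^ q = 1
    rw [hpow]
    simp
  · have key : ∀ k, k ≤ l → ∀ b : Fin (l + 1), k ≤ b →
        (((List.range k).map fun i => γ (u i) ^ e i).prod :
          Matrix (Fin (l + 1)) (Fin (l + 1)) (ZMod q)) 0 b =
        if (b : ℕ) = k then ∏ i ∈ Finset.range k, (e i : ZMod q) else 0 := by
      intro k
      induction k with
      | zero =>
        intro _ b _
        change (1 : Matrix (Fin (l + 1)) (Fin (l + 1)) (ZMod q)) 0 b = _
        rw [Matrix.one_apply, Finset.prod_range_zero]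
        exact if_congr ⟨fun h => by rw [← h]; rfl, fun h => Fin.ext h.symm⟩ rfl rfl
      | succ k ih =>
        intro hk b hb
        rw [List.range_succ, List.map_append, List.prod_append, List.map_singleton,
          List.prod_singleton]
        change (((((List.range k).map fun i => γ (u i) ^ e i).prod :
          Matrix (Fin (l + 1)) (Fin (l + 1)) (ZMod q)) * (1 + N (u k)) ^ e k) :
          Matrix (Fin (l + 1)) (Fin (l + 1)) (ZMod q)) 0 b = _
        rw [hpow, mul_add, mul_one, Matrix.add_apply, ih (by omega) b (by omega),
          if_neg (by omega), zero_add, Matrix.mul_apply]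
        by_cases hbk : (b : ℕ) = k + 1
        · rw [Finset.sum_eq_single (⟨k, by omega⟩ : Fin (l + 1)), ih (by omega) _ le_rfl,
            Matrix.smul_apply, hN, if_pos rfl, if_pos ⟨hbk, rfl⟩, if_pos hbk,
            Finset.prod_range_succ, smul_eq_mul, mul_one]
          · intro c _ hc
            rw [Matrix.smul_apply, hN, if_neg, smul_zero, mul_zero]
            rintro ⟨h1, -⟩
            exact hc (Fin.ext (by simp; omega))
          · simp
        · rw [if_neg hbk]
          refine Finset.sum_eq_zero fun c _ => ?_
          rw [Matrix.smul_apply, hN]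
          split_ifs with h1
          · rw [ih (by omega) c (by omega), if_neg (by omega), zero_mul]
          · simp
    have h1 := key l le_rfl (Fin.last l) le_rfl
    rw [h, if_pos (Fin.val_last l)] at h1
    change (1 : Matrix (Fin (l + 1)) (Fin (l + 1)) (ZMod q)) 0 (Fin.last l) = _ at h1
    rw [Matrix.one_apply_ne (by rw [Ne, Fin.ext_iff]; simp [hl.symm])] at h1
    obtain ⟨i, hi, h0⟩ := Finset.prod_eq_zero_iff.mp h1.symm
    exact he i (Finset.mem_range.mp hi) ((ZMod.natCast_eq_zero_iff _ _).mp h0)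

theorem MonoidAlgebra.eq_zero_of_mul_sum_single_eq_zero {k L S ι : Type*} [Field k] [Group L]
    [Group S] [UniqueProds S] (σ : L →* S) {I : Finset ι} (hI : I.Nonempty) {p : ι → L}
    (hp : Set.InjOn (fun i => σ (p i)) I) {ε : ι → k} (hε : ∀ i ∈ I, ε i ≠ 0)
    {a : MonoidAlgebra k L} (ha : a * ∑ i ∈ I, MonoidAlgebra.single (p i) (ε i) = 0) : a = 0 := by
  classical
  by_contra h0
  have hne : a.coeff.support.Nonempty := Finsupp.support_nonempty_iff.mpr fun h => h0 (MonoidAlgebra.coeff_eq_zero.mp h)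
  obtain ⟨s, hs, t, ht, hst⟩ := UniqueProds.uniqueMul_of_nonempty (hne.image σ)
    (hI.image fun i => σ (p i))
  obtain ⟨x, hx, rfl⟩ := Finset.mem_image.mp hs
  obtain ⟨i, hi, rfl⟩ := Finset.mem_image.mp ht
  have hval : (∑ i ∈ I, MonoidAlgebra.single (p i) (ε i) : MonoidAlgebra k L).coeff (p i) = ε i := by
    rw [MonoidAlgebra.coeff_sum, Finsupp.finsetSum_apply, Finset.sum_eq_single i]
    · exact Finsupp.single_eq_same
    · intro j hj hji
      refine Finsupp.single_eq_of_ne' fun h => hji (hp hj hi (congrArg σ h))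
    · exact fun h => absurd hi h
  have hsupp : ∀ y ∈ (∑ i ∈ I, MonoidAlgebra.single (p i) (ε i) : MonoidAlgebra k L).coeff.support,
      ∃ j ∈ I, y = p j := by
    intro y hy
    by_contra! hcon
    refine Finsupp.mem_support_iff.mp hy ?_
    rw [MonoidAlgebra.coeff_sum, Finsupp.finsetSum_apply]
    exact Finset.sum_eq_zero fun j hj => Finsupp.single_eq_of_ne (hcon j hj)
  have huniq : UniqueMul a.coeff.support
      (∑ i ∈ I, MonoidAlgebra.single (p i) (ε i) : MonoidAlgebra k L).coeff.support x (p i) := by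
    intro y z hy hz hyz
    obtain ⟨j, hj, rfl⟩ := hsupp z hz
    have h1 := (hst (Finset.mem_image_of_mem σ hy)
      (Finset.mem_image_of_mem (fun i => σ (p i)) hj) (by simp only [← map_mul, hyz])).2
    obtain rfl := hp hj hi h1
    exact ⟨mul_right_cancel hyz, rfl⟩
  have := MonoidAlgebra.coeff_mul_mul_of_uniqueMul huniq
  rw [ha, hval] at this
  exact mul_ne_zero (Finsupp.mem_support_iff.mp hx) (hε i hi) this.symm

section Fox

variable {S L : Type*} [Group L] (k : Type*) [CommRing k] (π : FreeGroup S →* L) (x : S)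

open Classical in
/-- The affine action of a free group on a group algebra whose translation part is a Fox
derivative. -/
noncomputable def foxPerm : FreeGroup S →* Equiv.Perm (MonoidAlgebra k L) :=
  FreeGroup.lift fun y =>
    { toFun := fun m => MonoidAlgebra.single (π (FreeGroup.of y)) 1 * m + if y = x then 1 else 0
      invFun := fun m =>
        MonoidAlgebra.single (π (FreeGroup.of y))⁻¹ 1 * (m - if y = x then 1 else 0)
      left_inv := fun m => by
        simp [← mul_assoc, MonoidAlgebra.single_mul_single, ← MonoidAlgebra.one_def]
      right_inv := fun m => by
        simp [← mul_assoc, MonoidAlgebra.single_mul_single, ← MonoidAlgebra.one_def] }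

/-- The Fox derivative with respect to the letter `x`, with coefficients pushed along `π`. -/
noncomputable def fox (g : FreeGroup S) : MonoidAlgebra k L := foxPerm k π x g 0

theorem foxPerm_apply (g : FreeGroup S) (m : MonoidAlgebra k L) :
    foxPerm k π x g m = MonoidAlgebra.single (π g) 1 * m + fox k π x g := by
  classical
  have hmul : ∀ g h : FreeGroup S,
      (∀ m, foxPerm k π x g m = MonoidAlgebra.single (π g) 1 * m + fox k π x g) →
      (∀ m, foxPerm k π x h m = MonoidAlgebra.single (π h) 1 * m + fox k π x h) →
      ∀ m, foxPerm k π x (g * h) m = MonoidAlgebra.single (π (g * h)) 1 * m +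
        fox k π x (g * h) := by
    intro g h hg hh m
    rw [fox, map_mul, Equiv.Perm.mul_apply, Equiv.Perm.mul_apply, hg, hh m, hg, hh 0, map_mul]
    simp [mul_add, ← mul_assoc, MonoidAlgebra.single_mul_single, add_assoc]
  have hone : ∀ m, foxPerm k π x 1 m = MonoidAlgebra.single (π 1) 1 * m + fox k π x 1 := by
    simp [fox, ← MonoidAlgebra.one_def]
  have hof : ∀ y m, foxPerm k π x (FreeGroup.of y) m =
      MonoidAlgebra.single (π (FreeGroup.of y)) 1 * m + fox k π x (FreeGroup.of y) := by
    intro y m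
    simp [fox, foxPerm]
  induction g using FreeGroup.induction_on generalizing m with
  | C1 => exact hone m
  | of y => exact hof y m
  | inv_of y _ =>
    rw [fox, map_inv, Equiv.Perm.inv_def, Equiv.symm_apply_eq, hof, mul_add, ← mul_assoc,
      MonoidAlgebra.single_mul_single, map_inv, mul_inv_cancel, one_mul, ← MonoidAlgebra.one_def,
      one_mul, add_assoc, ← hof, Equiv.apply_symm_apply, add_zero]
  | mul g h hg hh => exact hmul g h hg hh m

theorem fox_mul (g h : FreeGroup S) :
    fox k π x (g * h) = fox k π x g + MonoidAlgebra.single (π g) 1 * fox k π x h := by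
  rw [fox, map_mul, Equiv.Perm.mul_apply, foxPerm_apply, add_comm]
  rfl

@[simp]
theorem fox_one : fox k π x 1 = 0 := by simp [fox]

theorem fox_inv (g : FreeGroup S) :
    fox k π x g⁻¹ = -(MonoidAlgebra.single (π g)⁻¹ 1 * fox k π x g) := by
  have h := fox_mul k π x g⁻¹ g
  rw [inv_mul_cancel, fox_one, map_inv] at h
  exact eq_neg_of_add_eq_zero_left h.symm

theorem fox_pow (g : FreeGroup S) (n : ℕ) :
    fox k π x (g ^ n) =
      (∑ r ∈ Finset.range n, MonoidAlgebra.single (π g ^ r) 1) * fox k π x g := by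
  induction n with
  | zero => simp
  | succ n ih => rw [pow_succ, fox_mul, ih, Finset.sum_range_succ, add_mul, map_pow]

theorem fox_conj_pow (g v : FreeGroup S) (n : ℕ) (h : π (g ^ n) = 1) :
    fox k π x (v⁻¹ * g ^ n * v) =
      (∑ r ∈ Finset.range n, MonoidAlgebra.single ((π v)⁻¹ * π g ^ r) 1) * fox k π x g := by
  rw [fox_mul, fox_mul, fox_inv, map_mul, h, mul_one, map_inv, fox_pow, ← mul_assoc,
    Finset.mul_sum, neg_add_eq_sub, sub_add_cancel]
  simp [MonoidAlgebra.single_mul_single]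

theorem fox_mk [DecidableEq S] (l : List (S × Bool)) :
    fox k π x (FreeGroup.mk l) =
      ∑ i ∈ (Finset.range l.length).filter fun i => (l[i]?).map Prod.fst = some x,
        MonoidAlgebra.single
          (π (FreeGroup.mk (l.take (if (l[i]?).map Prod.snd = some true then i else i + 1))))
          (if (l[i]?).map Prod.snd = some true then 1 else -1) := by
  have hsingle : ∀ a : S × Bool, fox k π x (FreeGroup.mk [a]) =
      if a.1 = x then MonoidAlgebra.single (π (FreeGroup.mk (if a.2 then [] else [a])))
        (if a.2 then 1 else -1) else 0 := by
    have hof : ∀ y, fox k π x (FreeGroup.of y) = if y = x then 1 else 0 := by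
      intro y
      simp [fox, foxPerm]
    rintro ⟨y, b⟩
    rcases b with - | -
    · have : FreeGroup.mk [(y, false)] = (FreeGroup.of y)⁻¹ := rfl
      rw [this, fox_inv, hof]
      split_ifs with h <;> simp_all [← MonoidAlgebra.single_neg]
    · have : FreeGroup.mk [(y, true)] = FreeGroup.of y := rfl
      rw [this, hof]
      split_ifs with h <;> simp_all [MonoidAlgebra.one_def, ← FreeGroup.one_eq_mk]
  rw [Finset.sum_filter]
  induction l using List.reverseRecOn with
  | nil => simp [← FreeGroup.one_eq_mk]
  | append_singleton l a ih =>
    rw [← FreeGroup.mul_mk, fox_mul, ih, List.length_append, List.length_singleton,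
      Finset.sum_range_succ]
    congr 1
    · refine Finset.sum_congr rfl fun i hi => ?_
      have hi := Finset.mem_range.mp hi
      rw [List.getElem?_append_left hi, List.take_append_of_le_length]
      split_ifs <;> omega
    · rw [hsingle, List.getElem?_concat_length]
      obtain ⟨y, b⟩ := a
      have htake : (l ++ [(x, false)]).take (l.length + 1) = l ++ [(x, false)] :=
        List.take_of_length_le (by simp)
      rcases b with - | - <;> by_cases h : y = x <;>
        simp [h, htake, MonoidAlgebra.single_mul_single, ← map_mul, FreeGroup.mul_mk]

end Fox

theorem LinearIndependent.exists_linearMap_eq {k M ι : Type*} [Field k] [AddCommGroup M]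
    [Module k M] {e : ι → M} (he : LinearIndependent k e) (z : ι → k) :
    ∃ f : M →ₗ[k] k, ∀ i, f (e i) = z i := by
  obtain ⟨f, hf⟩ := LinearMap.exists_extend ((Module.Basis.span he).constr k z)
  refine ⟨f, fun i => ?_⟩
  have h : (Module.Basis.span he).constr k z ((Module.Basis.span he) i) = z i :=
    Module.Basis.constr_basis _ _ _ _
  rw [← hf, LinearMap.comp_apply, Submodule.subtype_apply, Module.Basis.span_apply] at h
  exact h

theorem exists_functional_conj_pow {S V : Type*} {q : ℕ} [Fact q.Prime] (T : Subgroup (FreeGroup S))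
    [T.Normal] (x : S) (c : FreeGroup S) {n : ℕ} (hn : n ≠ 0) (hc : c ^ n ∈ T)
    (hδ : ∀ a : MonoidAlgebra (ZMod q) (FreeGroup S ⧸ T),
      a * fox (ZMod q) (QuotientGroup.mk' T) x c = 0 → a = 0)
    (v : V → FreeGroup S)
    (hv : ∀ i j, ∀ r < n, v i * (v j)⁻¹ * c ^ r ∈ T → i = j ∧ r = 0)
    (t : V → T) (ht : ∀ i, (t i : FreeGroup S) = (v i)⁻¹ * c ^ n * v i) (z : V → ZMod q) :
    ∃ f : T →* Multiplicative (ZMod q), ∀ i, f (t i) = Multiplicative.ofAdd (z i) := by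
  classical
  set π := QuotientGroup.mk' T with hπ
  have hker : ∀ g, π g = 1 ↔ g ∈ T := fun g => QuotientGroup.eq_one_iff g
  let s : V → MonoidAlgebra (ZMod q) (FreeGroup S ⧸ T) := fun i =>
    ∑ r ∈ Finset.range n, MonoidAlgebra.single ((π (v i))⁻¹ * π c ^ r) 1
  have hs : ∀ i j, (s i).coeff (π (v j))⁻¹ = if i = j then 1 else 0 := by
    intro i j
    have hterm : ∀ r ∈ Finset.range n, (Finsupp.single ((π (v i))⁻¹ * π c ^ r) (1 : ZMod q))
        (π (v j))⁻¹ = if i = j ∧ r = 0 then 1 else 0 := by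
      intro r hr
      rw [Finsupp.single_apply]
      refine if_congr ⟨fun h => ?_, ?_⟩ rfl rfl
      · have : π (v j * (v i)⁻¹ * c ^ r) = 1 := by
          rw [map_mul, map_mul, map_inv, map_pow, mul_assoc, h, mul_inv_cancel]
        have := hv j i r (Finset.mem_range.mp hr) ((hker _).mp this)
        exact ⟨this.1.symm, this.2⟩
      · rintro ⟨rfl, rfl⟩
        simp
    rw [MonoidAlgebra.coeff_sum, Finsupp.finsetSum_apply]
    simp only [MonoidAlgebra.coeff_single]
    rw [Finset.sum_congr rfl hterm]
    by_cases hij : i = j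
    · simp [hij, Nat.pos_of_ne_zero hn]
    · simp [hij]
  have hli : LinearIndependent (ZMod q) fun i => s i * fox (ZMod q) π x c := by
    rw [linearIndependent_iff]
    intro l hl
    have h1 : (l.sum fun i a => a • s i) * fox (ZMod q) π x c = 0 := by
      rw [← hl, Finsupp.linearCombination_apply, Finsupp.sum, Finsupp.sum, Finset.sum_mul]
      simp only [smul_mul_assoc]
    ext j
    have h2 := congrArg (fun a => a.coeff (π (v j))⁻¹) (hδ _ h1)
    simp only [Finsupp.sum, MonoidAlgebra.coeff_sum, Finsupp.finsetSum_apply,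
      MonoidAlgebra.coeff_smul_apply, hs, MonoidAlgebra.coeff_zero] at h2
    simpa using h2
  obtain ⟨f, hf⟩ := hli.exists_linearMap_eq z
  refine ⟨⟨⟨fun g => Multiplicative.ofAdd (f (fox (ZMod q) π x g)), by simp⟩, ?_⟩, fun i => ?_⟩
  · intro g h
    simp only [Subgroup.coe_mul, fox_mul, (hker _).mpr g.2, ← MonoidAlgebra.one_def, one_mul,
      map_add, ofAdd_add]
  · change Multiplicative.ofAdd (f (fox (ZMod q) π x (t i))) = _
    rw [ht, fox_conj_pow _ _ _ _ _ _ ((hker _).mpr hc), hf]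

theorem exists_reduced_prod_of_mem_closure {Q U : Type*} [Group Q] {q : ℕ} (hq : q.Prime)
    (r : U → Q) (hr : ∀ u, r u ^ q = 1) {g : Q} (hg : g ∈ Subgroup.closure (Set.range r)) :
    ∃ L : List (U × ℕ), L.IsChain (fun a b => a.1 ≠ b.1) ∧ (∀ p ∈ L, ¬ q ∣ p.2) ∧
      (L.map fun p => r p.1 ^ p.2).prod = g := by
  classical
  have hmul : ∀ u (x : Q), (∃ L : List (U × ℕ), L.IsChain (fun a b => a.1 ≠ b.1) ∧
      (∀ p ∈ L, ¬ q ∣ p.2) ∧ (L.map fun p => r p.1 ^ p.2).prod = x) →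
      ∃ L : List (U × ℕ), L.IsChain (fun a b => a.1 ≠ b.1) ∧
      (∀ p ∈ L, ¬ q ∣ p.2) ∧ (L.map fun p => r p.1 ^ p.2).prod = r u * x := by
    rintro u x ⟨L, hL, hLq, rfl⟩
    have h1 : ¬ q ∣ 1 := hq.one_lt.ne' ∘ Nat.dvd_one.mp
    rcases L with - | ⟨⟨u', e⟩, L⟩
    · exact ⟨[(u, 1)], by simp, by simpa using h1, by simp⟩
    · by_cases huu : u = u'
      · subst huu
        by_cases he : q ∣ e + 1
        · refine ⟨L, hL.tail, fun p hp => hLq p (List.mem_cons_of_mem _ hp), ?_⟩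
          obtain ⟨m, hm⟩ := he
          rw [List.map_cons, List.prod_cons, ← mul_assoc, ← pow_succ', hm, pow_mul, hr, one_pow,
            one_mul]
        · refine ⟨(u, e + 1) :: L, ?_, ?_, ?_⟩
          · rw [List.isChain_cons] at hL ⊢
            exact hL
          · intro p hp
            rcases List.mem_cons.mp hp with rfl | hp
            · exact he
            · exact hLq p (List.mem_cons_of_mem _ hp)
          · rw [List.map_cons, List.prod_cons, List.map_cons, List.prod_cons, ← mul_assoc,
              pow_succ']
      · refine ⟨(u, 1) :: (u', e) :: L, ?_, ?_, ?_⟩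
        · exact List.isChain_cons_cons.mpr ⟨huu, hL⟩
        · intro p hp
          rcases List.mem_cons.mp hp with rfl | hp
          · exact h1
          · exact hLq p hp
        · simp
  have hpow : ∀ (n : ℕ) u (x : Q), (∃ L : List (U × ℕ), L.IsChain (fun a b => a.1 ≠ b.1) ∧
      (∀ p ∈ L, ¬ q ∣ p.2) ∧ (L.map fun p => r p.1 ^ p.2).prod = x) →
      ∃ L : List (U × ℕ), L.IsChain (fun a b => a.1 ≠ b.1) ∧
      (∀ p ∈ L, ¬ q ∣ p.2) ∧ (L.map fun p => r p.1 ^ p.2).prod = r u ^ n * x := by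
    intro n
    induction n with
    | zero => intro u x h; simpa using h
    | succ n ih => intro u x h; rw [pow_succ', mul_assoc]; exact hmul u _ (ih u x h)
  have hinv : ∀ u, (r u)⁻¹ = r u ^ (q - 1) := fun u => by
    rw [inv_eq_iff_mul_eq_one, ← pow_succ', Nat.sub_add_cancel hq.one_le, hr]
  induction hg using Subgroup.closure_induction_left with
  | one => exact ⟨[], by simp, by simp, by simp⟩
  | mul_left x hx y _ ih =>
    obtain ⟨u, rfl⟩ := hx
    exact hmul u y ih
  | inv_mul_cancel x hx y _ ih =>
    obtain ⟨u, rfl⟩ := hx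
    rw [hinv]
    exact hpow _ u y ih

theorem derivedSeries_add_le_map {G : Type*} [Group G] (T : Subgroup G) {d : ℕ}
    (h : derivedSeries G d ≤ T) (e : ℕ) :
    derivedSeries G (d + e) ≤ (derivedSeries T e).map T.subtype := by
  induction e with
  | zero =>
    rw [derivedSeries_zero, ← MonoidHom.range_eq_map, Subgroup.range_subtype]
    exact h
  | succ e ih =>
    rw [← add_assoc, derivedSeries_succ, derivedSeries_succ, Subgroup.map_commutator]
    exact Subgroup.commutator_mono ih ih

theorem exists_forall_notMem_sup {G : Type*} [Group G] {K : Subgroup G}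
    (h : ∀ g ∉ K, ∃ d, g ∉ derivedSeries G d ⊔ K) (B : Set G) (hB : B.Finite)
    (hBK : ∀ b ∈ B, b ∉ K) : ∃ d₀, ∀ d ≥ d₀, ∀ b ∈ B, b ∉ derivedSeries G d ⊔ K := by
  induction B, hB using Set.Finite.induction_on with
  | empty => exact ⟨0, by simp⟩
  | @insert a s _ _ ih =>
    obtain ⟨d₁, h₁⟩ := ih fun b hb => hBK b (Set.mem_insert_of_mem _ hb)
    obtain ⟨d₂, h₂⟩ := h a (hBK a (Set.mem_insert _ _))
    refine ⟨max d₁ d₂, fun d hd b hb => ?_⟩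
    rcases hb with rfl | hb
    · exact fun hmem => h₂ (sup_le_sup_right (derivedSeries_antitone G
        ((le_max_right _ _).trans hd)) K hmem)
    · exact h₁ d ((le_max_left _ _).trans hd) b hb

/-- The normal closure of `c ^ k` is generated by the conjugates of `c ^ k` by a set of elements
representing distinct cosets of the subgroup generated by `c` and that normal closure. -/
def CohenLyndon {F : Type*} [Group F] (c : F) (k : ℕ) : Prop :=
  ∃ U : Set F, Subgroup.normalClosure {c ^ k} ≤ Subgroup.closure {g | ∃ u ∈ U, u⁻¹ * c ^ k * u = g} ∧
    ∀ u₁ ∈ U, ∀ u₂ ∈ U, ∀ j : ℤ, u₁ * u₂⁻¹ * c ^ j ∈ Subgroup.normalClosure {c ^ k} → u₁ = u₂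

theorem exists_notMem_derivedSeries_sup_of_cohenLyndon {S : Type*} (x : S) (c : FreeGroup S)
    {q k : ℕ} [Fact q.Prime] (hk : k ≠ 0) (hcl : CohenLyndon c k)
    (hord : ∀ j : ℤ, c ^ j ∈ Subgroup.normalClosure {c ^ k} → (k : ℤ) ∣ j)
    (R : Subgroup (FreeGroup S)) [R.Normal] (hcR : c ∈ R) (i₀ : ℕ)
    (hR : derivedSeries (FreeGroup S) i₀ ≤ R)
    (hfox : ∀ (T : Subgroup (FreeGroup S)) [T.Normal], T ≤ R →
      ∀ a : MonoidAlgebra (ZMod q) (FreeGroup S ⧸ T),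
        a * fox (ZMod q) (QuotientGroup.mk' T) x c = 0 → a = 0)
    (hres : ∀ g ∉ Subgroup.normalClosure {c ^ k},
      ∃ d, g ∉ derivedSeries (FreeGroup S) d ⊔ Subgroup.normalClosure {c ^ k})
    (g : FreeGroup S) (hg : g ∉ Subgroup.normalClosure {c ^ (k * q)}) :
    ∃ d, g ∉ derivedSeries (FreeGroup S) d ⊔ Subgroup.normalClosure {c ^ (k * q)} := by
  classical
  set K := Subgroup.normalClosure {c ^ k} with hK
  set K' := Subgroup.normalClosure {c ^ (k * q)} with hK'
  have hcK : c ^ k ∈ K := Subgroup.subset_normalClosure rfl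
  have hKK' : K' ≤ K := Subgroup.normalClosure_le_normal (by
    rintro _ rfl
    rw [pow_mul]
    exact pow_mem hcK q)
  have hq : q.Prime := Fact.out
  by_cases hgK : g ∈ K
  swap
  · obtain ⟨d, hd⟩ := hres g hgK
    exact ⟨d, fun h => hd (sup_le_sup_left hKK' _ h)⟩
  obtain ⟨U, hUgen, hU⟩ := hcl
  -- write `g` as a reduced product of powers of conjugates
  obtain ⟨L, hLc, hLq, hLg⟩ := exists_reduced_prod_of_mem_closure (U := U) hq
    (fun u => (((u : FreeGroup S)⁻¹ * c ^ k * u : FreeGroup S) : FreeGroup S ⧸ K'))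
    (fun u => by
      rw [← QuotientGroup.mk_pow, QuotientGroup.eq_one_iff]
      have := conj_pow (i := q) (a := (u : FreeGroup S)⁻¹) (b := c ^ k)
      rw [inv_inv, ← pow_mul] at this
      rw [this]
      have h := Subgroup.normalClosure_normal.conj_mem (c ^ (k * q))
        (Subgroup.subset_normalClosure (s := {c ^ (k * q)}) rfl) (u : FreeGroup S)⁻¹
      rwa [inv_inv] at h)
    (g := (g : FreeGroup S ⧸ K')) (by
      have := Subgroup.mem_map_of_mem (QuotientGroup.mk' K') (hUgen hgK)
      rw [MonoidHom.map_closure] at this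
      refine Subgroup.closure_mono ?_ this
      rintro _ ⟨_, ⟨u, hu, rfl⟩, rfl⟩
      exact ⟨⟨u, hu⟩, rfl⟩)
  have hL0 : L ≠ [] := by
    rintro rfl
    exact hg ((QuotientGroup.eq_one_iff _).mp hLg.symm)
  -- choose a term of the derived series
  let B : Set (FreeGroup S) :=
    {b | b ∉ K ∧ ∃ p ∈ L, ∃ p' ∈ L, ∃ r < k, (p.1 : FreeGroup S) * (p'.1 : FreeGroup S)⁻¹ * c ^ r = b}
  have hB : B.Finite := by
    refine ((L.toFinset ×ˢ L.toFinset ×ˢ Finset.range k).finite_toSet.image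
      fun t => (t.1.1 : FreeGroup S) * (t.2.1.1 : FreeGroup S)⁻¹ * c ^ t.2.2).subset ?_
    rintro b ⟨-, p, hp, p', hp', r, hr, rfl⟩
    exact ⟨(p, p', r), by simp [hp, hp', hr], rfl⟩
  obtain ⟨d₀, hd₀⟩ := exists_forall_notMem_sup hres B hB fun b hb => hb.1
  let d := max d₀ i₀
  let T := derivedSeries (FreeGroup S) d ⊔ K
  have hT : ∀ p ∈ L, ∀ p' ∈ L, ∀ r < k, (p.1 : FreeGroup S) * (p'.1 : FreeGroup S)⁻¹ * c ^ r ∈ T →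
      (p.1 : FreeGroup S) * (p'.1 : FreeGroup S)⁻¹ * c ^ r ∈ K := by
    intro p hp p' hp' r hr h
    by_contra hcon
    exact hd₀ d (le_max_left _ _) _ ⟨hcon, p, hp, p', hp', r, hr, rfl⟩ h
  have hKT : K ≤ T := le_sup_right
  have hTn : T.Normal := inferInstance
  have hTR : T ≤ R := sup_le ((derivedSeries_antitone _ (le_max_right _ _)).trans hR)
    (Subgroup.normalClosure_le_normal (by rintro _ rfl; exact pow_mem hcR k))
  have hcT : ∀ r < k, c ^ r ∈ T → r = 0 := by
    intro r hr h
    obtain ⟨p, hp⟩ := List.exists_mem_of_ne_nil L hL0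
    have h1 := hT p hp p hp r hr (by simpa using h)
    rw [mul_inv_cancel, one_mul] at h1
    have := hord r (by simpa using h1)
    exact Nat.eq_zero_of_dvd_of_lt (Int.natCast_dvd_natCast.mp this) hr
  let H := Subgroup.zpowers c ⊔ T
  have hH : ∀ h ∈ H, ∃ r < k, h * c ^ r ∈ T := by
    intro h hh
    obtain ⟨_, ⟨j, rfl⟩, t, ht, rfl⟩ := Subgroup.mem_sup_of_normal_right.mp hh
    refine ⟨((-j) % k).toNat, ?_, ?_⟩
    · have := Int.emod_lt_of_pos (-j) (b := k) (by omega)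
      omega
    · have h0 := Int.emod_nonneg (-j) (b := k) (by omega)
      have h1 : c ^ ((-j) % k).toNat = c ^ (-j) * (c ^ k) ^ (-((-j) / k)) := by
        rw [← zpow_natCast, Int.toNat_of_nonneg h0, ← zpow_natCast c k, ← zpow_mul, ← zpow_add,
          Int.emod_def]
        congr 1
        ring
      rw [h1, ← mul_assoc]
      refine mul_mem ?_ (zpow_mem (hKT hcK) _)
      rw [zpow_neg]
      exact hTn.conj_mem t ht (c ^ j)
  -- coset representatives
  let V := Quotient (QuotientGroup.rightRel H)
  have hrel : ∀ a b : FreeGroup S, (Quotient.mk (QuotientGroup.rightRel H) a = Quotient.mk _ b) ↔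
      b * a⁻¹ ∈ H := fun a b => by
    rw [Quotient.eq, QuotientGroup.rightRel_apply]
  let rep : V → FreeGroup S := fun v =>
    if h : ∃ p ∈ L, Quotient.mk (QuotientGroup.rightRel H) (p.1 : FreeGroup S) = v then h.choose.1
    else v.out
  have hrep_mk : ∀ v : V, Quotient.mk (QuotientGroup.rightRel H) (rep v) = v := by
    intro v
    by_cases h : ∃ p ∈ L, Quotient.mk (QuotientGroup.rightRel H) (p.1 : FreeGroup S) = v
    · simp only [rep, dif_pos h]
      exact h.choose_spec.2
    · simp only [rep, dif_neg h]
      exact Quotient.out_eq v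
  have hrep : ∀ p ∈ L, rep (Quotient.mk _ (p.1 : FreeGroup S)) = p.1 := by
    intro p hp
    have h : ∃ p' ∈ L, Quotient.mk (QuotientGroup.rightRel H) (p'.1 : FreeGroup S) =
      Quotient.mk (QuotientGroup.rightRel H) (p.1 : FreeGroup S) := ⟨p, hp, rfl⟩
    simp only [rep, dif_pos h]
    obtain ⟨hp', hpp⟩ := h.choose_spec
    obtain ⟨r, hr, hrT⟩ := hH _ ((hrel _ _).mp hpp)
    exact (hU _ p.1.2 _ h.choose.1.2 r (by simpa using hT p hp _ hp' r hr hrT)).symm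
  have hHT : ∀ (h : FreeGroup S) (r : ℕ), h * c ^ r ∈ T → h ∈ H := by
    intro h r hr
    have h1 : c ^ r ∈ H := (le_sup_left : _ ≤ H) (pow_mem (Subgroup.mem_zpowers c) r)
    exact (Subgroup.mul_mem_cancel_right _ h1).mp ((le_sup_right : T ≤ H) hr)
  have hv : ∀ i j : V, ∀ r < k, rep i * (rep j)⁻¹ * c ^ r ∈ T → i = j ∧ r = 0 := by
    intro i j r hr h
    have h1 : i = j := by
      rw [← hrep_mk i, ← hrep_mk j]
      exact ((hrel _ _).mpr (hHT _ _ h)).symm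
    subst h1
    exact ⟨rfl, hcT r hr (by simpa using h)⟩
  have ht : ∀ v : FreeGroup S, v⁻¹ * c ^ k * v ∈ T := fun v => by
    simpa using hTn.conj_mem _ (hKT hcK) v⁻¹
  let t : V → T := fun v => ⟨(rep v)⁻¹ * c ^ k * rep v, ht _⟩
  have hfun := exists_functional_conj_pow (q := q) T x c hk (hKT hcK) (hfox T hTR) rep hv t
    fun _ => rfl
  -- the finite `q`-group detecting `g`
  obtain ⟨p₀, hp₀⟩ := List.exists_mem_of_ne_nil L hL0
  have hget : ∀ i, i < L.length → L.getD i p₀ ∈ L := fun i hi => by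
    rw [List.getD_eq_getElem _ _ hi]
    exact List.getElem_mem hi
  obtain ⟨P, _, _, γ, hP, hγ, hγL⟩ := exists_isPGroup_prod_ne_one q L.length
    (mt List.length_eq_zero_iff.mp hL0) (fun i => ((L.getD i p₀).1 : FreeGroup S))
    (fun i hi h => by
      have h1 := List.isChain_iff_getElem.mp hLc i hi
      rw [List.getD_eq_getElem _ _ hi, List.getD_eq_getElem _ _ (by omega)] at h
      exact h1 (Subtype.ext h))
    (fun i => (L.getD i p₀).2) (fun i hi => hLq _ (hget i hi))
  obtain ⟨θ, hθ⟩ := exists_hom_of_exists_functional t hfun P hP fun v => γ (rep v)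
  let M := θ.ker.map T.subtype
  have hK'M : K' ≤ M := by
    refine (Subgroup.closure_le _).mpr ?_
    intro y hy
    rw [Group.mem_conjugatesOfSet_iff] at hy
    obtain ⟨_, rfl, hy⟩ := hy
    obtain ⟨f, rfl⟩ := isConj_iff.mp hy
    have h1 : (rep (Quotient.mk _ f⁻¹)) * f ∈ H := by
      have := (hrel f⁻¹ _).mp (hrep_mk (Quotient.mk _ f⁻¹)).symm
      rwa [inv_inv] at this
    obtain ⟨r, hr, hrT⟩ := hH _ h1
    set v := rep (Quotient.mk _ f⁻¹) with hvdef
    have hτ : v⁻¹ * (v * f * c ^ r) * v ∈ T := by simpa using hTn.conj_mem _ hrT v⁻¹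
    let τ : T := ⟨_, hτ⟩
    refine ⟨τ * t (Quotient.mk _ f⁻¹) ^ q * τ⁻¹, ?_, ?_⟩
    · change θ _ = 1
      rw [map_mul, map_mul, map_pow, hθ, hγ, mul_one, map_inv, mul_inv_cancel]
    · change v⁻¹ * (v * f * c ^ r) * v * (v⁻¹ * c ^ k * v) ^ q * (v⁻¹ * (v * f * c ^ r) * v)⁻¹ = _
      have h2 : (v⁻¹ * c ^ k * v) ^ q = v⁻¹ * c ^ (k * q) * v := by
        have := conj_pow (i := q) (a := v⁻¹) (b := c ^ k)
        rw [inv_inv, ← pow_mul] at this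
        exact this
      have h3 : c ^ r * c ^ (k * q) * (c ^ r)⁻¹ = c ^ (k * q) := by
        rw [← pow_add, add_comm, pow_add, mul_inv_cancel_right]
      calc _ = f * (c ^ r * c ^ (k * q) * (c ^ r)⁻¹) * f⁻¹ := by rw [h2]; group
        _ = _ := by rw [h3]
  have hgM : g ∉ M := by
    rintro ⟨g', hg', hgg⟩
    let s : T := (L.map fun p => t (Quotient.mk _ (p.1 : FreeGroup S)) ^ p.2).prod
    have hs : ((s : FreeGroup S) : FreeGroup S ⧸ K') = g := by
      rw [← hLg]
      have h1 : (s : FreeGroup S) = (L.map fun p =>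
          ((p.1 : FreeGroup S)⁻¹ * c ^ k * p.1) ^ p.2).prod := by
        rw [← Subgroup.coe_subtype, map_list_prod, List.map_map]
        refine congrArg List.prod (List.map_congr_left fun p hp => ?_)
        simp only [Function.comp_apply, map_pow, Subgroup.subtype_apply, t, hrep p hp]
      rw [h1, ← QuotientGroup.mk'_apply, map_list_prod, List.map_map]
      rfl
    rw [QuotientGroup.eq] at hs
    obtain ⟨z, hz, hzs⟩ := hK'M hs
    have h2 : g' = s * z := Subtype.ext (by
      rw [Subgroup.coe_mul]
      change (g' : FreeGroup S) = g at hgg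
      change (z : FreeGroup S) = _ at hzs
      rw [hgg, hzs, mul_inv_cancel_left])
    have h3 : θ s = 1 := by
      have h4 : θ g' = 1 := hg'
      have h5 : θ z = 1 := hz
      rwa [h2, map_mul, h5, mul_one] at h4
    refine hγL (Eq.trans ?_ h3)
    rw [map_list_prod, List.map_map]
    congr 1
    refine List.ext_getElem (by simp) fun i h₁ h₂ => ?_
    have hi : i < L.length := by simpa using h₁
    simp only [List.getElem_map, List.getElem_range, Function.comp_apply, map_pow, hθ,
      List.getD_eq_getElem _ _ hi, hrep _ (List.getElem_mem hi)]
  have : Group.IsSolvable P := by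
    have := hP.isNilpotent
    infer_instance
  obtain ⟨e, he⟩ := Group.IsSolvable.solvable (G := P)
  refine ⟨d + e, fun hmem => hgM (sup_le ?_ hK'M hmem)⟩
  refine (derivedSeries_add_le_map T le_sup_left e).trans (Subgroup.map_mono fun y hy => ?_)
  have h1 := map_derivedSeries_le_derivedSeries θ e (Subgroup.mem_map_of_mem θ hy)
  rw [he] at h1
  exact h1

theorem derivedSeries_le_ratDerived (G : Type*) [Group G] (i : ℕ) :
    derivedSeries G i ≤ ratDerived G i := by
  induction i with
  | zero => exact le_top
  | succ i ih =>
    rw [derivedSeries_succ]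
    exact (Subgroup.commutator_mono ih ih).trans (commutator_ratDerived_le i)

/-- No proper nonempty subword of `l` lies in the normal closure of `l`. -/
def SubwordProperty {S : Type*} (l : List (S × Bool)) : Prop :=
  ∀ A B C : List (S × Bool), l = A ++ B ++ C → B ≠ [] → A ++ C ≠ [] →
    FreeGroup.mk B ∉ Subgroup.normalClosure {FreeGroup.mk l}

theorem SubwordProperty.take_notMem {S : Type*} {l : List (S × Bool)} (hl : SubwordProperty l)
    {a b : ℕ} (hab : a < b) (hb : b ≤ l.length) (h : 0 < a ∨ b < l.length) :
    (FreeGroup.mk (l.take a))⁻¹ * FreeGroup.mk (l.take b) ∉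
      Subgroup.normalClosure {FreeGroup.mk l} := by
  have h1 : l.take b = l.take a ++ (l.take b).drop a := by
    have := List.take_append_drop a (l.take b)
    rwa [List.take_take, min_eq_left hab.le, eq_comm] at this
  rw [h1, ← FreeGroup.mul_mk, inv_mul_cancel_left]
  refine hl (l.take a) _ (l.drop b) ?_ ?_ ?_
  · rw [← h1, List.take_append_drop]
  · rw [Ne, ← List.length_eq_zero_iff, List.length_drop, List.length_take]
    omega
  · rw [Ne, ← List.length_eq_zero_iff, List.length_append, List.length_drop, List.length_take]
    omega

theorem SubwordProperty.fox_position_notMem {S : Type*} {l : List (S × Bool)}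
    (hl : SubwordProperty l) (hred : FreeGroup.IsReduced (l ++ l)) {x : S} {a b : ℕ} (hab : a < b)
    (hb : b < l.length) (hax : (l[a]?).map Prod.fst = some x) (hbx : (l[b]?).map Prod.fst = some x) :
    (FreeGroup.mk (l.take (if (l[a]?).map Prod.snd = some true then a else a + 1)))⁻¹ *
      FreeGroup.mk (l.take (if (l[b]?).map Prod.snd = some true then b else b + 1)) ∉
      Subgroup.normalClosure {FreeGroup.mk l} := by
  rw [FreeGroup.IsReduced, List.isChain_iff_getElem] at hred
  have ha : a < l.length := by omega
  rw [List.getElem?_eq_getElem ha, List.getElem?_eq_getElem hb] at *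
  simp only [Option.map_some, Option.some.injEq] at *
  split_ifs with h1 h2 h2
  · exact hl.take_notMem hab hb.le (Or.inr hb)
  · by_cases h3 : 0 < a ∨ b + 1 < l.length
    · exact hl.take_notMem (by omega) (by omega) h3
    · exfalso
      have h4 := hred b (by rw [List.length_append]; omega)
      rw [List.getElem_append_left hb, List.getElem_append_right (by omega)] at h4
      have h5 : b + 1 - l.length = a := by omega
      simp only [h5] at h4
      exact h2 ((h4 (hbx.trans hax.symm)).trans h1)
  · by_cases h3 : a + 1 < b
    · exact hl.take_notMem h3 hb.le (Or.inl (by omega))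
    · exfalso
      have h5 : b = a + 1 := by omega
      subst h5
      have h4 := hred a (by rw [List.length_append]; omega)
      rw [List.getElem_append_left ha, List.getElem_append_left hb] at h4
      exact h1 ((h4 (hax.trans hbx.symm)).trans h2)
  · exact hl.take_notMem (by omega) (by omega) (Or.inl (by omega))

theorem SubwordProperty.fox_regular {S : Type*} {l : List (S × Bool)} (hl : SubwordProperty l)
    (hred : FreeGroup.IsReduced (l ++ l)) {x : S} (hx : x ∈ l.map Prod.fst)
    (h : ResiduallyQSolvable (FreeGroup S ⧸ Subgroup.normalClosure {FreeGroup.mk l})) (q : ℕ)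
    [Fact q.Prime] :
    ∃ (R : Subgroup (FreeGroup S)) (_ : R.Normal) (i₀ : ℕ), FreeGroup.mk l ∈ R ∧
      derivedSeries (FreeGroup S) i₀ ≤ R ∧
      ∀ (T : Subgroup (FreeGroup S)) [T.Normal], T ≤ R →
        ∀ a : MonoidAlgebra (ZMod q) (FreeGroup S ⧸ T),
          a * fox (ZMod q) (QuotientGroup.mk' T) x (FreeGroup.mk l) = 0 → a = 0 := by
  classical
  set N := Subgroup.normalClosure {FreeGroup.mk l} with hN
  let pos : ℕ → FreeGroup S := fun a =>
    FreeGroup.mk (l.take (if (l[a]?).map Prod.snd = some true then a else a + 1))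
  let I := (Finset.range l.length).filter fun i => (l[i]?).map Prod.fst = some x
  have hI : I.Nonempty := by
    obtain ⟨p, hp, rfl⟩ := List.mem_map.mp hx
    obtain ⟨i, hi, rfl⟩ := List.getElem_of_mem hp
    exact ⟨i, Finset.mem_filter.mpr ⟨Finset.mem_range.mpr hi, by
      rw [List.getElem?_eq_getElem hi]; rfl⟩⟩
  have hex : ∀ t : ℕ × ℕ, ∃ i, t.1 ∈ I → t.2 ∈ I → t.1 < t.2 →
      ((pos t.1)⁻¹ * pos t.2 : FreeGroup S) ∉ (ratDerived (FreeGroup S ⧸ N) i).comap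
        (QuotientGroup.mk' N) := by
    intro t
    by_contra! hcon
    have h1 := (hcon 0).1
    have h2 := (hcon 0).2.1
    refine hl.fox_position_notMem hred (hcon 0).2.2.1
      (Finset.mem_range.mp (Finset.mem_filter.mp h2).1) (Finset.mem_filter.mp h1).2
      (Finset.mem_filter.mp h2).2 ?_
    rw [← QuotientGroup.eq_one_iff, ← Subgroup.mem_bot, ← h, ratDerivedOmega, Subgroup.mem_iInf]
    exact fun i => (hcon i).2.2.2
  choose f hf using hex
  let i₀ := (I ×ˢ I).sup f
  refine ⟨(ratDerived (FreeGroup S ⧸ N) i₀).comap (QuotientGroup.mk' N), inferInstance, i₀, ?_, ?_,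
    ?_⟩
  · have h1 : ((FreeGroup.mk l : FreeGroup S) : FreeGroup S ⧸ N) = 1 :=
      (QuotientGroup.eq_one_iff _).mpr (Subgroup.subset_normalClosure rfl)
    rw [Subgroup.mem_comap, QuotientGroup.mk'_apply, h1]
    exact one_mem _
  · rw [← Subgroup.map_le_iff_le_comap]
    exact (map_derivedSeries_le_derivedSeries _ _).trans (derivedSeries_le_ratDerived _ _)
  · intro T _ hTR a ha
    have := uniqueProds_quotient_ratDerived (FreeGroup S ⧸ N) i₀
    let σ : FreeGroup S ⧸ T →* (FreeGroup S ⧸ N) ⧸ ratDerived (FreeGroup S ⧸ N) i₀ :=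
      QuotientGroup.lift T ((QuotientGroup.mk' _).comp (QuotientGroup.mk' N)) fun y hy =>
        (QuotientGroup.eq_one_iff _).mpr (hTR hy)
    rw [fox_mk] at ha
    have hne : ∀ i ∈ I, ∀ j ∈ I, i < j → σ (QuotientGroup.mk' T (pos i)) ≠
        σ (QuotientGroup.mk' T (pos j)) := by
      intro i hi j hj hij heq
      refine hf (i, j) hi hj hij (ratDerived_antitone _
        (Finset.le_sup (f := f) (Finset.mk_mem_product hi hj)) ?_)
      rw [map_mul, map_inv]
      exact QuotientGroup.eq.mp heq
    refine MonoidAlgebra.eq_zero_of_mul_sum_single_eq_zero σ hI (fun i hi j hj hij => ?_)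
      (fun i _ => ?_) ha
    · by_contra hij'
      rcases lt_or_gt_of_ne hij' with h' | h'
      · exact hne i hi j hj h' hij
      · exact hne j hj i hi h' hij.symm
    · split_ifs <;> simp

theorem exists_notMem_derivedSeries_sup {S : Type*} {l : List (S × Bool)} (hl0 : l ≠ [])
    (hred : FreeGroup.IsReduced (l ++ l)) (hl : SubwordProperty l)
    (hcl : ∀ k, CohenLyndon (FreeGroup.mk l) k)
    (hord : ∀ (k : ℕ) (j : ℤ), FreeGroup.mk l ^ j ∈ Subgroup.normalClosure {FreeGroup.mk l ^ k} →
      (k : ℤ) ∣ j)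
    (h : ResiduallyQSolvable (FreeGroup S ⧸ Subgroup.normalClosure {FreeGroup.mk l})) {n : ℕ}
    (hn : n ≠ 0) : ∀ g ∉ Subgroup.normalClosure {FreeGroup.mk l ^ n},
    ∃ d, g ∉ derivedSeries (FreeGroup S) d ⊔ Subgroup.normalClosure {FreeGroup.mk l ^ n} := by
  induction n using induction_on_primes with
  | zero => exact absurd rfl hn
  | one =>
    rw [pow_one]
    intro g hg
    set N := Subgroup.normalClosure {FreeGroup.mk l} with hN
    by_contra! hcon
    refine hg ?_
    rw [← QuotientGroup.eq_one_iff, ← Subgroup.mem_bot, ← h, ratDerivedOmega, Subgroup.mem_iInf]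
    intro i
    have h1 : derivedSeries (FreeGroup S) i ⊔ N ≤
        (ratDerived (FreeGroup S ⧸ N) i).comap (QuotientGroup.mk' N) := by
      refine sup_le ?_ fun y hy => ?_
      · rw [← Subgroup.map_le_iff_le_comap]
        exact (map_derivedSeries_le_derivedSeries _ _).trans (derivedSeries_le_ratDerived _ _)
      · rw [Subgroup.mem_comap, QuotientGroup.mk'_apply, (QuotientGroup.eq_one_iff _).mpr hy]
        exact one_mem _
    exact h1 (hcon i)
  | prime_mul q k hq ih =>
    have : Fact q.Prime := ⟨hq⟩
    have hk : k ≠ 0 := right_ne_zero_of_mul hn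
    obtain ⟨p, hp⟩ := List.exists_mem_of_ne_nil l hl0
    obtain ⟨R, _, i₀, hR, hiR, hfox⟩ :=
      hl.fox_regular hred (List.mem_map_of_mem (f := Prod.fst) hp) h q
    rw [mul_comm]
    exact exists_notMem_derivedSeries_sup_of_cohenLyndon p.1 _ hk (hcl k) (hord k) R hR i₀ hiR hfox
      (ih hk)

theorem Subgroup.zpow_mul_mul_zpow_mem {G : Type*} [Group G] {Q : Subgroup G} {x y : G} {M : ℤ}
    (hM : M ≠ 0) (hx : x ^ M ∈ Q)
    (h : ∀ i : ℤ, 0 ≤ i → i < |M| → x ^ i * y * x ^ (-i) ∈ Q) (i : ℤ) :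
    x ^ i * y * x ^ (-i) ∈ Q := by
  have h1 : x ^ i * y * x ^ (-i) =
      (x ^ M) ^ (i / M) * (x ^ (i % M) * y * x ^ (-(i % M))) * ((x ^ M) ^ (i / M))⁻¹ := by
    nth_rw 1 2 [← Int.emod_add_mul_ediv i M]
    rw [add_comm (i % M), neg_add_rev, zpow_add, zpow_add, zpow_mul, zpow_neg x (M * (i / M)),
      zpow_mul]
    group
  rw [h1]
  exact mul_mem (mul_mem (zpow_mem hx _) (h _ (Int.emod_nonneg _ hM) (Int.emod_lt_abs _ hM)))
    (inv_mem (zpow_mem hx _))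

open Classical in
/-- The action of the free group on `FreeGroup ({y // y ≠ x} × ZMod N) × ZMod N` in which `x`
translates the second factor. -/
noncomputable def FreeGroup.rotation {X : Type*} (x : X) (N : ℕ) :
    FreeGroup X →* Equiv.Perm (FreeGroup ({y // y ≠ x} × ZMod N) × ZMod N) :=
  FreeGroup.lift fun z =>
    if h : z = x then Equiv.prodCongr (Equiv.refl _) (Equiv.addRight 1)
    else
      { toFun := fun p => (FreeGroup.of (⟨z, h⟩, -p.2) * p.1, p.2)
        invFun := fun p => ((FreeGroup.of (⟨z, h⟩, -p.2))⁻¹ * p.1, p.2)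
        left_inv := fun p => by simp
        right_inv := fun p => by simp }

theorem FreeGroup.rotation_of_zpow {X : Type*} (x : X) (N : ℕ) (i : ℤ)
    (p : FreeGroup ({y // y ≠ x} × ZMod N) × ZMod N) :
    FreeGroup.rotation x N (FreeGroup.of x ^ i) p = (p.1, p.2 + i) := by
  have h1 : ∀ p, FreeGroup.rotation x N (FreeGroup.of x) p = (p.1, p.2 + 1) := fun p => by
    simp [FreeGroup.rotation, Prod.map]
  induction i generalizing p with
  | zero => simp
  | succ i ih => rw [zpow_add, zpow_one, _root_.map_mul, Equiv.Perm.mul_apply, h1, ih]; simp; ring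
  | pred i ih =>
    rw [zpow_sub, zpow_one, _root_.map_mul, Equiv.Perm.mul_apply, _root_.map_inv]
    have : (FreeGroup.rotation x N (FreeGroup.of x))⁻¹ p = (p.1, p.2 - 1) := by
      rw [Equiv.Perm.inv_eq_iff_eq, h1]
      simp
    rw [this, ih]; simp; ring

theorem FreeGroup.rotation_of_ne {X : Type*} {x y : X} (hy : y ≠ x) (N : ℕ)
    (p : FreeGroup ({y // y ≠ x} × ZMod N) × ZMod N) :
    FreeGroup.rotation x N (FreeGroup.of y) p = (FreeGroup.of (⟨y, hy⟩, -p.2) * p.1, p.2) := by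
  simp [FreeGroup.rotation, hy]

theorem FreeGroup.rotation_lift {X : Type*} (x : X) (N : ℕ) [NeZero N] (q g : FreeGroup ({y // y ≠ x} × ZMod N)) :
    FreeGroup.rotation x N (FreeGroup.lift (fun e : {y // y ≠ x} × ZMod N =>
      FreeGroup.of x ^ (e.2.val : ℤ) * FreeGroup.of e.1.1 * FreeGroup.of x ^ (-(e.2.val : ℤ))) q)
      (g, 0) = (q * g, 0) := by
  have h1 : ∀ (e : {y // y ≠ x} × ZMod N) (g : FreeGroup ({y // y ≠ x} × ZMod N)),
      FreeGroup.rotation x N (FreeGroup.of x ^ (e.2.val : ℤ) * FreeGroup.of e.1.1 *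
        FreeGroup.of x ^ (-(e.2.val : ℤ))) (g, 0) = (FreeGroup.of e * g, 0) := by
    intro e g
    rw [_root_.map_mul, _root_.map_mul, Equiv.Perm.mul_apply, Equiv.Perm.mul_apply, FreeGroup.rotation_of_zpow,
      FreeGroup.rotation_of_ne e.1.2, FreeGroup.rotation_of_zpow]
    simp
  induction q using FreeGroup.induction_on generalizing g with
  | C1 => simp
  | of e => rw [FreeGroup.lift_apply_of, h1]
  | inv_of e _ =>
    rw [_root_.map_inv, _root_.map_inv, Equiv.Perm.inv_eq_iff_eq, FreeGroup.lift_apply_of, h1,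
      mul_inv_cancel_left]
  | mul a b ha hb => rw [_root_.map_mul, _root_.map_mul, Equiv.Perm.mul_apply, hb, ha, mul_assoc]

theorem cohenLyndon_of_zpow {X : Type*} (x : X) (r : ℤ) (k : ℕ) :
    CohenLyndon (FreeGroup.of x ^ r) k := by
  rcases eq_or_ne (r * k) 0 with hM | hM
  · refine ⟨∅, ?_, by simp⟩
    rw [← zpow_natCast, ← zpow_mul, hM, zpow_zero]
    refine (Subgroup.normalClosure_le_normal (N := ⊥) (by simp)).trans bot_le
  set N := (r * k).natAbs with hN
  have : NeZero N := ⟨by simpa [N] using hM⟩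
  set τ := FreeGroup.lift (fun e : {y // y ≠ x} × ZMod N =>
      FreeGroup.of x ^ (e.2.val : ℤ) * FreeGroup.of e.1.1 * FreeGroup.of x ^ (-(e.2.val : ℤ)))
  have hxk : (FreeGroup.of x ^ r) ^ k = FreeGroup.of x ^ (r * k) := by
    rw [← zpow_natCast, ← zpow_mul]
  rw [CohenLyndon, hxk]
  refine ⟨τ.range, ?_, ?_⟩
  · set W₁ := Subgroup.closure {g | ∃ u ∈ (τ.range : Set (FreeGroup X)),
      u⁻¹ * FreeGroup.of x ^ (r * k) * u = g} with hW₁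
    have hMW : FreeGroup.of x ^ (r * k) ∈ W₁ :=
      Subgroup.subset_closure ⟨1, one_mem τ.range, by simp⟩
    have hQ1 : τ.range ⊔ W₁ ≤ Subgroup.normalizer (W₁ : Set (FreeGroup X)) := by
      refine sup_le ?_ Subgroup.le_normalizer
      rw [Subgroup.le_normalizer_closure_iff]
      rintro p hp _ ⟨u, hu, rfl⟩
      refine Subgroup.subset_closure ⟨u * p⁻¹, mul_mem hu (inv_mem hp), by group⟩
    have hQ2 : ∀ y ≠ x, ∀ i : ℤ, FreeGroup.of x ^ i * FreeGroup.of y * FreeGroup.of x ^ (-i) ∈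
        τ.range ⊔ W₁ := by
      intro y hy
      refine Subgroup.zpow_mul_mul_zpow_mem hM (Subgroup.mem_sup_right hMW) fun i h0 h1 => ?_
      refine Subgroup.mem_sup_left ⟨FreeGroup.of (⟨y, hy⟩, (i : ZMod N)), ?_⟩
      have h2 : ((i : ZMod N).val : ℤ) = i := by
        rw [ZMod.val_intCast, Int.emod_eq_of_lt h0]
        rwa [hN, Int.natCast_natAbs]
      rw [FreeGroup.lift_apply_of]
      simp only [h2]
    have hQ3 : ∀ v : FreeGroup X, ∀ a : ℤ, ∀ q ∈ τ.range ⊔ W₁, ∃ b : ℤ, ∃ q' ∈ τ.range ⊔ W₁,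
        v * (FreeGroup.of x ^ a * q) = FreeGroup.of x ^ b * q' := by
      intro v
      induction v using FreeGroup.induction_on with
      | C1 => exact fun a q hq => ⟨a, q, hq, one_mul _⟩
      | of y =>
        intro a q hq
        by_cases hy : y = x
        · exact ⟨1 + a, q, hq, by rw [hy, zpow_add, zpow_one, mul_assoc]⟩
        · refine ⟨a, _, mul_mem (hQ2 y hy (-a)) hq, ?_⟩
          group
      | inv_of y _ =>
        intro a q hq
        by_cases hy : y = x
        · exact ⟨-1 + a, q, hq, by rw [hy, zpow_add, zpow_neg_one, mul_assoc]⟩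
        · refine ⟨a, _, mul_mem (inv_mem (hQ2 y hy (-a))) hq, ?_⟩
          group
      | mul v₁ v₂ h₁ h₂ =>
        intro a q hq
        obtain ⟨b, q', hq', h⟩ := h₂ a q hq
        obtain ⟨b', q'', hq'', h'⟩ := h₁ b q' hq'
        exact ⟨b', q'', hq'', by rw [mul_assoc, h, h']⟩
    rw [Subgroup.normalClosure, Subgroup.closure_le]
    intro g hg
    obtain ⟨_, rfl, hg⟩ := Group.mem_conjugatesOfSet_iff.mp hg
    obtain ⟨v, rfl⟩ := isConj_iff.mp hg
    obtain ⟨b, q, hq, h⟩ := hQ3 v⁻¹ 0 1 (one_mem _)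
    rw [zpow_zero, one_mul, mul_one] at h
    have h1 := (Subgroup.mem_normalizer_iff.mp (inv_mem (hQ1 hq)) _).mp hMW
    rw [← inv_inv v, h]
    rw [SetLike.mem_coe]
    convert h1 using 1
    group
  · rintro _ ⟨q₁, rfl⟩ _ ⟨q₂, rfl⟩ j hj
    have h1 : Subgroup.normalClosure {FreeGroup.of x ^ (r * k)} ≤
        (FreeGroup.rotation x N).ker := by
      refine Subgroup.normalClosure_le_normal ?_
      rintro _ rfl
      ext1 p
      rw [FreeGroup.rotation_of_zpow, Equiv.Perm.one_apply]
      have : ((r * k : ℤ) : ZMod N) = 0 := by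
        rw [ZMod.intCast_zmod_eq_zero_iff_dvd, hN, Int.natAbs_dvd]
      rw [this, add_zero]
    have h2 := h1 hj
    rw [← _root_.map_inv, ← _root_.map_mul, ← zpow_mul, MonoidHom.mem_ker, _root_.map_mul, mul_eq_one_iff_eq_inv,
      ← _root_.map_inv, ← zpow_neg] at h2
    have h3 := congrArg (fun f => (f (1, 0)).1) h2
    simp only [FreeGroup.rotation_of_zpow] at h3
    rw [FreeGroup.rotation_lift, mul_one, mul_inv_eq_one] at h3
    rw [h3]

theorem FreeGroup.exists_cocycle {Y Ω K : Type*} [Group Ω] [Group K] (π : FreeGroup Y →* Ω)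
    (e : Y → Ω → K) :
    ∃ C : FreeGroup Y → Ω → K, (∀ g h ω, C (g * h) ω = C g (π h * ω) * C h ω) ∧
      ∀ y ω, C (FreeGroup.of y) ω = e y ω := by
  let Θ : FreeGroup Y →* Equiv.Perm (Ω × K) := FreeGroup.lift fun y =>
    { toFun := fun p => (π (FreeGroup.of y) * p.1, e y p.1 * p.2)
      invFun := fun p => ((π (FreeGroup.of y))⁻¹ * p.1, (e y ((π (FreeGroup.of y))⁻¹ * p.1))⁻¹ * p.2)
      left_inv := fun p => by simp
      right_inv := fun p => by simp }
  have hof : ∀ y p, Θ (FreeGroup.of y) p = (π (FreeGroup.of y) * p.1, e y p.1 * p.2) := fun y p => by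
    simp [Θ]
  have key : ∀ g p, Θ g p = (π g * p.1, (Θ g (p.1, 1)).2 * p.2) := by
    intro g
    induction g using FreeGroup.induction_on with
    | C1 => simp
    | of y => intro p; rw [hof, hof]; simp
    | inv_of y _ =>
      intro p
      have h1 : ∀ p, Θ (FreeGroup.of y)⁻¹ p = ((π (FreeGroup.of y))⁻¹ * p.1,
          (e y ((π (FreeGroup.of y))⁻¹ * p.1))⁻¹ * p.2) := by
        intro p
        rw [_root_.map_inv, Equiv.Perm.inv_eq_iff_eq, hof]
        simp
      rw [h1, h1, _root_.map_inv, mul_one]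
    | mul a b ha hb =>
      intro p
      have h1 : ∀ q, Θ (a * b) q = Θ a (Θ b q) := fun q => by
        rw [_root_.map_mul, Equiv.Perm.mul_apply]
      rw [h1, h1, hb p, ha, ha (Θ b _), hb (p.1, 1), _root_.map_mul]
      simp [mul_assoc]
  refine ⟨fun g ω => (Θ g (ω, 1)).2, fun g h ω => ?_, fun y ω => by simp [hof]⟩
  simp only
  rw [_root_.map_mul, Equiv.Perm.mul_apply, key h, key g]

/-- The Cohen-Lyndon property descends from a free product with an infinite cyclic group. -/
theorem CohenLyndon.of_map_some {X : Type*} {c : FreeGroup X} {k : ℕ}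
    (h : CohenLyndon (FreeGroup.map some c) k) : CohenLyndon c k := by
  classical
  set ι : FreeGroup X →* FreeGroup (Option X) := FreeGroup.map some with hι
  let ρ : FreeGroup (Option X) →* FreeGroup X :=
    FreeGroup.lift fun y => y.elim 1 FreeGroup.of
  have hρ : ∀ g, ρ (ι g) = g := by
    have : ρ.comp ι = MonoidHom.id _ := FreeGroup.ext_hom _ _ fun x => by simp [ρ, ι]
    exact fun g => DFunLike.congr_fun this g
  set W := Subgroup.normalClosure {c ^ k} with hW
  set V := Subgroup.normalClosure {ι c ^ k} with hV
  have hVρ : V ≤ W.comap ρ := by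
    refine Subgroup.normalClosure_le_normal ?_
    rintro _ rfl
    rw [SetLike.mem_coe, Subgroup.mem_comap, _root_.map_pow, hρ]
    exact Subgroup.subset_normalClosure rfl
  have hWι : W ≤ V.comap ι := by
    refine Subgroup.normalClosure_le_normal ?_
    rintro _ rfl
    rw [SetLike.mem_coe, Subgroup.mem_comap, _root_.map_pow]
    exact Subgroup.subset_normalClosure rfl
  let π := QuotientGroup.mk' V
  have hπ : ∀ g, π (ι g) = 1 ↔ g ∈ W := by
    intro g
    rw [QuotientGroup.mk'_apply, QuotientGroup.eq_one_iff]
    exact ⟨fun hg => by simpa [hρ] using hVρ hg, fun hg => hWι hg⟩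
  have hπV : ∀ g, g ∈ V ↔ π g = 1 := fun g => (QuotientGroup.eq_one_iff g).symm
  obtain ⟨τ, hτ, hτ1⟩ : ∃ τ : FreeGroup (Option X) ⧸ V → FreeGroup X,
      (∀ g, π (ι (τ (π (ι g)))) = π (ι g)) ∧ τ 1 = 1 := by
    have : ∀ ω, ∃ g, ω ∈ (π.comp ι).range → π (ι g) = ω := by
      intro ω
      by_cases hω : ω ∈ (π.comp ι).range
      · obtain ⟨g, hg⟩ := hω
        exact ⟨g, fun _ => hg⟩
      · exact ⟨1, fun h => absurd h hω⟩
    choose τ hτ using this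
    refine ⟨Function.update τ 1 1, fun g => ?_, by simp⟩
    by_cases h1 : π (ι g) = 1
    · rw [h1]; simp
    · rw [Function.update_of_ne h1]
      exact hτ _ ⟨g, rfl⟩
  obtain ⟨C, hC, hCof⟩ := FreeGroup.exists_cocycle π fun y ω =>
    y.elim (1 : FreeGroup X) fun x => if ω ∈ (π.comp ι).range then
      (τ (π (ι (FreeGroup.of x)) * ω))⁻¹ * FreeGroup.of x * τ ω else 1
  have hC1 : ∀ ω, C 1 ω = 1 := by
    intro ω
    have := hC 1 1 ω
    simpa using this
  have hCinv : ∀ g ω, C g⁻¹ (π g * ω) = (C g ω)⁻¹ := by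
    intro g ω
    have := hC g⁻¹ g ω
    rw [inv_mul_cancel, hC1] at this
    exact eq_inv_of_mul_eq_one_left this.symm
  have hCinv' : ∀ g ω, C g⁻¹ ω = (C g ((π g)⁻¹ * ω))⁻¹ := by
    intro g ω
    rw [← hCinv, mul_inv_cancel_left]
  have hCx : ∀ x ω, C (ι (FreeGroup.of x)) ω = if ω ∈ (π.comp ι).range then
      (τ (π (ι (FreeGroup.of x)) * ω))⁻¹ * FreeGroup.of x * τ ω else 1 := fun x ω => by
    refine Eq.trans (congrArg (C · ω) FreeGroup.map.of) (hCof (some x) ω)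
  have hran : ∀ g, π (ι g) ∈ (π.comp ι).range := fun g => ⟨g, rfl⟩
  have hCin : ∀ g v, C (ι g) (π (ι v)) = (τ (π (ι (g * v))))⁻¹ * g * τ (π (ι v)) := by
    intro g
    have hx : ∀ x v, C (ι (FreeGroup.of x)) (π (ι v)) =
        (τ (π (ι (FreeGroup.of x * v))))⁻¹ * FreeGroup.of x * τ (π (ι v)) := by
      intro x v
      rw [hCx, if_pos ⟨v, rfl⟩, _root_.map_mul, _root_.map_mul]
    induction g using FreeGroup.induction_on with
    | C1 => intro v; simp [hC1]
    | of x => exact hx x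
    | inv_of x _ =>
      intro v
      rw [_root_.map_inv, hCinv', ← _root_.map_inv, ← _root_.map_inv, ← _root_.map_mul,
        ← _root_.map_mul, hx, mul_inv_cancel_left]
      group
    | mul a b ha hb =>
      intro v
      rw [_root_.map_mul, hC, hb, ← _root_.map_mul, ← _root_.map_mul, ha, mul_assoc a b v]
      group
  have hCout : ∀ g ω, ω ∉ (π.comp ι).range → C (ι g) ω = 1 := by
    intro g
    have hx : ∀ x ω, ω ∉ (π.comp ι).range → C (ι (FreeGroup.of x)) ω = 1 := by
      intro x ω hω
      rw [hCx, if_neg hω]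
    induction g using FreeGroup.induction_on with
    | C1 => intro v; simp [hC1]
    | of x => exact hx x
    | inv_of x _ =>
      intro ω hω
      rw [_root_.map_inv, hCinv', hx, inv_one]
      rwa [Subgroup.mul_mem_cancel_left _ (inv_mem (hran _))]
    | mul a b ha hb =>
      intro ω hω
      rw [_root_.map_mul, hC, hb ω hω, ha, one_mul]
      rwa [Subgroup.mul_mem_cancel_left _ (hran b)]
  have hCW : ∀ g ω, C g ω ∈ W := by
    intro g
    have hx : ∀ y ω, C (FreeGroup.of y) ω ∈ W := by
      intro y ω
      rw [hCof]
      cases y with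
      | none => exact one_mem _
      | some x =>
        simp only [Option.elim_some]
        split_ifs with hω
        · obtain ⟨g, rfl⟩ := hω
          rw [← hπ, MonoidHom.comp_apply, ← _root_.map_mul, ← _root_.map_mul]
          simp only [_root_.map_mul ι ((τ _)⁻¹ * _), _root_.map_mul ι (τ _)⁻¹, _root_.map_mul π,
            _root_.map_inv, hτ]
          rw [_root_.map_mul ι, _root_.map_mul π]
          group
        · exact one_mem _
    induction g using FreeGroup.induction_on with
    | C1 => intro ω; rw [hC1]; exact one_mem _
    | of y => exact hx y
    | inv_of y _ => intro ω; rw [hCinv']; exact inv_mem (hx _ _)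
    | mul a b ha hb => intro ω; rw [hC]; exact mul_mem (ha _) (hb _)
  obtain ⟨U, hU, hUinj⟩ := h
  let u : FreeGroup (Option X) → FreeGroup X := fun y => τ (π y) * C y 1
  have hu : ∀ y, π y ∈ (π.comp ι).range → π (ι (u y)) = π y := by
    rintro y ⟨g, hg⟩
    simp only [u]
    rw [← hg, MonoidHom.comp_apply, _root_.map_mul, _root_.map_mul, hτ, (hπ _).mpr (hCW _ _), mul_one]
  refine ⟨{v | ∃ y ∈ U, π y ∈ (π.comp ι).range ∧ u y = v}, ?_, ?_⟩
  · intro w hw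
    set D := Subgroup.closure {g | ∃ v ∈ {v | ∃ y ∈ U, π y ∈ (π.comp ι).range ∧ u y = v},
      v⁻¹ * c ^ k * v = g}
    have hck : π (ι c ^ k) = 1 := (hπV _).mp (Subgroup.subset_normalClosure rfl)
    have h1 : ∀ z ∈ Subgroup.closure {g | ∃ v ∈ U, v⁻¹ * ι c ^ k * v = g},
        π z = 1 ∧ C z 1 ∈ D := by
      intro z hz
      induction hz using Subgroup.closure_induction with
      | mem z hz =>
        obtain ⟨y, hy, rfl⟩ := hz
        refine ⟨by rw [_root_.map_mul, _root_.map_mul, hck]; simp, ?_⟩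
        rw [hC, hC, hck, one_mul, mul_one, hCinv', inv_mul_cancel]
        by_cases hyr : π y ∈ (π.comp ι).range
        · refine Subgroup.subset_closure ⟨u y, ⟨y, hy, hyr, rfl⟩, ?_⟩
          obtain ⟨g, hg⟩ := hyr
          have h2 := hCin (c ^ k) g
          rw [_root_.map_mul ι, _root_.map_mul π, _root_.map_pow ι, hck, one_mul] at h2
          rw [MonoidHom.comp_apply] at hg
          rw [← hg, h2, hg]
          simp only [u]
          group
        · have h2 := hCout (c ^ k) _ hyr
          rw [_root_.map_pow ι] at h2
          rw [h2, mul_one, inv_mul_cancel]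
          exact one_mem _
      | one => exact ⟨_root_.map_one _, by rw [hC1]; exact one_mem _⟩
      | mul a b _ _ ha hb =>
        refine ⟨by rw [_root_.map_mul, ha.1, hb.1, one_mul], ?_⟩
        rw [hC, hb.1, one_mul]
        exact mul_mem ha.2 hb.2
      | inv a _ ha =>
        refine ⟨by rw [_root_.map_inv, ha.1, inv_one], ?_⟩
        rw [hCinv', ha.1, inv_one, one_mul]
        exact inv_mem ha.2
    have h2 := (h1 (ι w) (hU (hWι hw))).2
    have h3 := hCin w 1
    rw [mul_one, _root_.map_one, _root_.map_one, (hπ w).mpr hw, hτ1] at h3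
    rw [h3] at h2
    simpa using h2
  · rintro _ ⟨y₁, hy₁, h₁, rfl⟩ _ ⟨y₂, hy₂, h₂, rfl⟩ j hj
    have h3 : y₁ = y₂ := by
      refine hUinj y₁ hy₁ y₂ hy₂ j ?_
      rw [← hπ] at hj
      rw [hπV, ← hj]
      simp only [_root_.map_mul, _root_.map_inv, _root_.map_zpow, hu _ h₁, hu _ h₂]
    rw [h3]

/-- Abstract form of the inductive step: if `H` is generated by `ι F` and `s`, with `s` conjugating
`ι ∘ a` to `ι ∘ b`, and `H` maps onto the corresponding HNN extension of `F ⧸ ⟪w ^ k⟫`, then the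
Cohen-Lyndon property of `w` passes to `ι w`. -/
theorem CohenLyndon.of_hnnExtension {F D H : Type*} [Group F] [Group D] [Group H] {w : F} {k : ℕ}
    {A B : Subgroup (F ⧸ Subgroup.normalClosure {w ^ k})} {φ : A ≃* B} (a b : D →* F)
    (ha : (a.range.map (QuotientGroup.mk' _)) = A) (hb : (b.range.map (QuotientGroup.mk' _)) = B)
    (ι : F →* H) (s : H) (hs : ∀ d, s * ι (a d) = ι (b d) * s)
    (hgen : Subgroup.closure (insert s (Set.range ι)) = ⊤)
    (Ψ : H →* HNNExtension (F ⧸ Subgroup.normalClosure {w ^ k}) A B φ)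
    (hΨι : ∀ g, Ψ (ι g) = HNNExtension.of (QuotientGroup.mk' _ g)) (hΨs : Ψ s = HNNExtension.t)
    (hcl : CohenLyndon w k) : CohenLyndon (ι w) k := by
  set N := Subgroup.normalClosure {w ^ k} with hN
  let π := QuotientGroup.mk' N
  obtain ⟨d⟩ : Nonempty (HNNExtension.NormalWord.TransversalPair (F ⧸ N) A B) := inferInstance
  obtain ⟨sec, hsec⟩ := (QuotientGroup.mk'_surjective N).hasRightInverse
  obtain ⟨U, hU, hUinj⟩ := hcl
  let f : List (ℤˣ × (F ⧸ N)) → H := fun L => (L.map fun p => s ^ (p.1 : ℤ) * ι (sec p.2)).prod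
  have hfcons : ∀ p L, f (p :: L) = s ^ (p.1 : ℤ) * ι (sec p.2) * f L := fun p L => by simp [f]
  have hΨf : ∀ (g : F) (p : HNNExtension.NormalWord d), Ψ (ι g * f p.toList) =
      ({ p with head := π g } : HNNExtension.NormalWord d).prod φ := by
    intro g p
    rw [map_mul, hΨι, HNNExtension.NormalWord.ReducedWord.prod]
    congr 1
    simp only [f]
    rw [map_list_prod, List.map_map]
    congr 1
    refine List.map_congr_left fun q _ => ?_
    simp only [Function.comp_apply, map_mul, map_zpow, hΨs, hΨι]
    rw [hsec]
  have hadj : ∀ ε : ℤˣ, ∃ a' b' : D →* F,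
      (∀ x, x ∈ HNNExtension.toSubgroup A B ε ↔ ∃ e, π (a' e) = x) ∧
      ∀ e, s ^ (ε : ℤ) * ι (a' e) = ι (b' e) * s ^ (ε : ℤ) := by
    intro ε
    rcases Int.units_eq_one_or ε with rfl | rfl
    · refine ⟨a, b, fun x => ?_, fun e => by simpa using hs e⟩
      rw [HNNExtension.toSubgroup_one, ← ha]
      simp [π, N]
    · refine ⟨b, a, fun x => ?_, fun e => ?_⟩
      · rw [HNNExtension.toSubgroup_neg_one, ← hb]
        simp [π, N]
      · simp only [Units.val_neg, Units.val_one, zpow_neg_one]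
        rw [inv_mul_eq_iff_eq_mul, ← mul_assoc, hs, mul_inv_cancel_right]
  let T : Set H := {v | ∃ p : HNNExtension.NormalWord d, ∃ u ∈ U, ι u * f p.toList = v}
  set W₁ := Subgroup.closure {g | ∃ v ∈ T, v⁻¹ * ι w ^ k * v = g} with hW₁
  have hconj : ∀ (p : HNNExtension.NormalWord d), ∀ n ∈ N,
      (f p.toList)⁻¹ * ι n * f p.toList ∈ W₁ := by
    intro p n hn
    have := hU hn
    induction this using Subgroup.closure_induction with
    | mem x hx =>
      obtain ⟨u, hu, rfl⟩ := hx
      refine Subgroup.subset_closure ⟨_, ⟨p, u, hu, rfl⟩, ?_⟩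
      simp only [map_mul, map_inv, map_pow]
      group
    | one => simp
    | mul x y hx hy hx' hy' =>
      have e : (f p.toList)⁻¹ * ι (x * y) * f p.toList =
          ((f p.toList)⁻¹ * ι x * f p.toList) * ((f p.toList)⁻¹ * ι y * f p.toList) := by
        rw [map_mul]; group
      have hle : Subgroup.closure {g | ∃ u ∈ U, u⁻¹ * w ^ k * u = g} ≤ N := by
        rw [Subgroup.closure_le]
        rintro _ ⟨u, -, rfl⟩
        have := Subgroup.normalClosure_normal.conj_mem _
          (Subgroup.subset_normalClosure (Set.mem_singleton (w ^ k))) u⁻¹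
        rwa [inv_inv] at this
      rw [e]
      exact mul_mem (hx' (hle hx)) (hy' (hle hy))
    | inv x hx hx' =>
      have e : (f p.toList)⁻¹ * ι x⁻¹ * f p.toList =
          ((f p.toList)⁻¹ * ι x * f p.toList)⁻¹ := by
        rw [map_inv]; group
      rw [e]
      exact inv_mem (hx' (by simpa using hn))
  have hstep : ∀ (ε : ℤˣ) (p : HNNExtension.NormalWord d) (u : F), ∀ v ∈ W₁,
      ∃ (p' : HNNExtension.NormalWord d) (u' : F), ∃ v' ∈ W₁,
        s ^ (ε : ℤ) * (ι u * f p.toList * v) = ι u' * f p'.toList * v' := by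
    intro ε p u v hv
    obtain ⟨a', b', hmem, hcomm⟩ := hadj ε
    by_cases hcase : π u ∈ HNNExtension.toSubgroup A B ε ∧ ∃ g L, p.toList = (-ε, g) :: L
    · obtain ⟨hx, g, L, hL⟩ := hcase
      obtain ⟨e, he⟩ := (hmem _).mp hx
      have hn : (a' e)⁻¹ * u ∈ N := QuotientGroup.eq.mp he
      have hp1 := p.mem_set
      have hp2 := p.chain
      rw [hL] at hp1 hp2
      refine ⟨⟨⟨1, L, (List.isChain_cons.mp hp2).2⟩, fun u g h => hp1 u g (List.mem_cons_of_mem _ h)⟩,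
        b' e * sec g, _, mul_mem (hconj p _ hn) hv, ?_⟩
      have h1 : u = a' e * ((a' e)⁻¹ * u) := by group
      have h2 : s ^ (ε : ℤ) * f p.toList = ι (sec g) * f L := by
        rw [hL, hfcons]
        simp only [Units.val_neg, zpow_neg]
        group
      nth_rw 1 [h1]
      simp only
      calc s ^ (ε : ℤ) * (ι (a' e * ((a' e)⁻¹ * u)) * f p.toList * v)
          = (s ^ (ε : ℤ) * ι (a' e)) * (ι ((a' e)⁻¹ * u) * f p.toList * v) := by
            rw [map_mul]; group
        _ = ι (b' e) * (s ^ (ε : ℤ) * f p.toList) *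
            ((f p.toList)⁻¹ * ι ((a' e)⁻¹ * u) * f p.toList * v) := by rw [hcomm]; group
        _ = _ := by rw [h2, map_mul ι (b' e)]; group
    · obtain ⟨⟨⟨a₀, ha₀⟩, ⟨r, hr⟩⟩, hx⟩ := (d.compl ε).2 (π u)
      simp only at hx
      obtain ⟨e, rfl⟩ := (hmem _).mp ha₀
      have hn : (a' e * sec r)⁻¹ * u ∈ N := by
        refine QuotientGroup.eq.mp (Eq.trans ?_ hx)
        refine (map_mul π _ _).trans ?_
        congr 1
        exact hsec r
      refine ⟨HNNExtension.NormalWord.cons 1 ε { p with head := r } hr ?_,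
        b' e, _, mul_mem (hconj p _ hn) hv, ?_⟩
      · intro u' hu' hr'
        by_contra hne
        refine hcase ⟨by rw [← hx]; exact mul_mem ha₀ hr', ?_⟩
        simp only at hu'
        obtain ⟨⟨u'', g⟩, hq, rfl⟩ := Option.map_eq_some_iff.mp hu'
        obtain ⟨L, hL⟩ := List.head?_eq_some_iff.mp hq
        refine ⟨g, L, ?_⟩
        rw [hL]
        congr 2
        simp only at hne
        rcases Int.units_eq_one_or ε with rfl | rfl <;>
          rcases Int.units_eq_one_or u'' with rfl | rfl <;> simp_all
      · have h1 : u = a' e * (sec r * ((a' e * sec r)⁻¹ * u)) := by group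
        simp only [HNNExtension.NormalWord.cons_toList]
        rw [hfcons]
        nth_rw 1 [h1]
        simp only
        calc s ^ (ε : ℤ) * (ι (a' e * (sec r * ((a' e * sec r)⁻¹ * u))) * f p.toList * v)
            = (s ^ (ε : ℤ) * ι (a' e)) * ι (sec r) * (ι ((a' e * sec r)⁻¹ * u) * f p.toList * v) := by
              rw [map_mul, map_mul]; group
          _ = _ := by rw [hcomm]; group
  have hall : ∀ g : H, ∀ (p : HNNExtension.NormalWord d) (u : F), ∀ v ∈ W₁,
      ∃ (p' : HNNExtension.NormalWord d) (u' : F), ∃ v' ∈ W₁,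
        g * (ι u * f p.toList * v) = ι u' * f p'.toList * v' := by
    intro g
    have hg : g ∈ Subgroup.closure (insert s (Set.range ι)) := hgen ▸ Subgroup.mem_top g
    induction hg using Subgroup.closure_induction'' with
    | mem x hx =>
      intro p u v hv
      rcases hx with rfl | ⟨y, rfl⟩
      · simpa using hstep 1 p u v hv
      · exact ⟨p, y * u, v, hv, by rw [map_mul]; group⟩
    | inv_mem x hx =>
      intro p u v hv
      rcases hx with rfl | ⟨y, rfl⟩
      · simpa using hstep (-1) p u v hv
      · exact ⟨p, y⁻¹ * u, v, hv, by rw [map_mul, map_inv]; group⟩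
    | one => exact fun p u v hv => ⟨p, u, v, hv, one_mul _⟩
    | mul x y _ _ hx hy =>
      intro p u v hv
      obtain ⟨p', u', v', hv', h⟩ := hy p u v hv
      obtain ⟨p'', u'', v'', hv'', h'⟩ := hx p' u' v' hv'
      exact ⟨p'', u'', v'', hv'', by rw [mul_assoc, h, h']⟩
  refine ⟨T, ?_, ?_⟩
  · rw [Subgroup.normalClosure, Subgroup.closure_le]
    intro g hg
    obtain ⟨_, rfl, hg⟩ := Group.mem_conjugatesOfSet_iff.mp hg
    obtain ⟨v, rfl⟩ := isConj_iff.mp hg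
    obtain ⟨p, u, v', hv', h⟩ := hall v⁻¹ HNNExtension.NormalWord.empty 1 1 (one_mem _)
    have h0 : ι 1 * f (HNNExtension.NormalWord.empty : HNNExtension.NormalWord d).toList * 1 = 1 := by
      simp [f]
    rw [h0, mul_one] at h
    have hn : u⁻¹ * w ^ k * u ∈ N := by
      have := Subgroup.normalClosure_normal.conj_mem _
          (Subgroup.subset_normalClosure (Set.mem_singleton (w ^ k))) u⁻¹
      rwa [inv_inv] at this
    rw [← inv_inv v, h, SetLike.mem_coe]
    have h1 := mul_mem (mul_mem (inv_mem hv') (hconj p _ hn)) hv'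
    convert h1 using 1
    simp only [map_mul, map_inv, map_pow]
    group
  · rintro _ ⟨p₁, u₁, hu₁, rfl⟩ _ ⟨p₂, u₂, hu₂, rfl⟩ j hj
    have hker : Subgroup.normalClosure {ι w ^ k} ≤ Ψ.ker := by
      refine Subgroup.normalClosure_le_normal ?_
      rintro _ rfl
      rw [SetLike.mem_coe, MonoidHom.mem_ker, ← map_pow, hΨι]
      have : QuotientGroup.mk' N (w ^ k) = 1 :=
        (QuotientGroup.eq_one_iff _).mpr (Subgroup.subset_normalClosure rfl)
      rw [this, map_one]
    have h1 := hker hj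
    rw [MonoidHom.mem_ker] at h1
    have h2 : Ψ (ι u₁ * f p₁.toList) = Ψ (ι (w ^ (-j) * u₂) * f p₂.toList) := by
      have e : ι (w ^ (-j) * u₂) * f p₂.toList =
          (ι u₁ * f p₁.toList * (ι u₂ * f p₂.toList)⁻¹ * ι w ^ j)⁻¹ * (ι u₁ * f p₁.toList) := by
        rw [map_mul, map_zpow]; group
      rw [e, map_mul _ _⁻¹, map_inv, h1, inv_one, one_mul]
    rw [hΨf, hΨf] at h2
    have h3 := HNNExtension.NormalWord.prod_injective φ d h2
    have h4 : π u₁ = π (w ^ (-j) * u₂) := congrArg (fun q => q.head) h3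
    have h5 : p₁.toList = p₂.toList := congrArg (fun q => q.toList) h3
    have h6 : u₁ = u₂ := by
      refine hUinj u₁ hu₁ u₂ hu₂ j ?_
      rw [← QuotientGroup.eq_one_iff]
      change π (u₁ * u₂⁻¹ * w ^ j) = 1
      rw [map_mul, map_mul, h4, ← map_mul, ← map_mul]
      have : w ^ (-j) * u₂ * u₂⁻¹ * w ^ j = 1 := by group
      rw [this, map_one]
    rw [h5, h6]

/-- The level at which a signed letter starts; the letter `y` leads from `lev y` to
`lev y + wt y`. -/
def levelSource {Y : Type*} (lev wt : Y → ℤ) (e : Y × Bool) : ℤ :=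
  cond e.2 (lev e.1) (lev e.1 + wt e.1)

/-- The level at which a signed letter ends. -/
def levelTarget {Y : Type*} (lev wt : Y → ℤ) (e : Y × Bool) : ℤ :=
  cond e.2 (lev e.1 + wt e.1) (lev e.1)

/-- The word `L` is a path from level `l` to level `l'`. -/
def IsLevelPath {Y : Type*} (lev wt : Y → ℤ) : ℤ → List (Y × Bool) → ℤ → Prop
  | l, [], l' => l = l'
  | l, e :: L, l' => levelSource lev wt e = l ∧ IsLevelPath lev wt (levelTarget lev wt e) L l'

section

variable {Y : Type*} {lev wt : Y → ℤ}

theorem isLevelPath_append {l l' : ℤ} {A B : List (Y × Bool)} :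
    IsLevelPath lev wt l (A ++ B) l' ↔
      ∃ m, IsLevelPath lev wt l A m ∧ IsLevelPath lev wt m B l' := by
  induction A generalizing l with
  | nil => simp [IsLevelPath]
  | cons e A ih => simp only [List.cons_append, IsLevelPath, ih]; tauto

theorem isLevelPath_map {Z : Type*} (f : Z → Y) {l l' : ℤ} {L : List (Z × Bool)} :
    IsLevelPath lev wt l (L.map (Prod.map f id)) l' ↔
      IsLevelPath (lev ∘ f) (wt ∘ f) l L l' := by
  induction L generalizing l with
  | nil => rfl
  | cons e L ih =>
    simp only [List.map_cons, IsLevelPath, ih]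
    rfl

theorem IsLevelPath.lift_mk {K : Type*} [Group K] (T : ℤ → K) (g : Y → K) {l l' : ℤ}
    {L : List (Y × Bool)} (h : IsLevelPath lev wt l L l') :
    FreeGroup.lift (fun y => T (lev y) * g y * (T (lev y + wt y))⁻¹) (FreeGroup.mk L) =
      T l * FreeGroup.lift g (FreeGroup.mk L) * (T l')⁻¹ := by
  induction L generalizing l with
  | nil => obtain rfl : l = l' := h; simp [← FreeGroup.one_eq_mk]
  | cons e L ih =>
    obtain ⟨rfl, h⟩ := h
    have key : ∀ f : Y → K, FreeGroup.lift f (FreeGroup.mk (e :: L)) =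
        cond e.2 (f e.1) (f e.1)⁻¹ * FreeGroup.lift f (FreeGroup.mk L) := by
      intro f
      simp [FreeGroup.lift_mk]
    rw [key, key, ih h]
    rcases e with ⟨y, _ | _⟩ <;> simp [levelSource, levelTarget, mul_assoc]

theorem FreeGroup.IsReduced.of_append_append {L B : List (Y × Bool)} (h : FreeGroup.IsReduced L)
    (A C : List (Y × Bool)) (hL : A ++ B ++ C = L) : FreeGroup.IsReduced B := by
  subst hL
  rw [FreeGroup.IsReduced, List.isChain_append, List.isChain_append] at h
  exact h.1.2.1

theorem FreeGroup.IsReduced.of_map {Z : Type*} {f : Z → Y} {L : List (Z × Bool)}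
    (h : FreeGroup.IsReduced (L.map (Prod.map f id))) : FreeGroup.IsReduced L := by
  rw [FreeGroup.IsReduced, List.isChain_map] at h
  exact List.IsChain.imp (fun a b hab e => hab (congrArg f e)) h

variable {δ : ℤ → Y} {a : ℤ}

/-- A nonempty reduced path in the letters `δ i` is not closed. -/
theorem IsLevelPath.ne_of_forall_mem_range (ha : a ≠ 0) (hlev : ∀ i, lev (δ i) = i)
    (hwt : ∀ i, wt (δ i) = a) {l l' : ℤ} {J : List (Y × Bool)} (hJ : IsLevelPath lev wt l J l')
    (hδ : ∀ e ∈ J, e.1 ∈ Set.range δ) (hred : FreeGroup.IsReduced J) (hne : J ≠ []) : l ≠ l' := by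
  have key : ∀ (J : List (Y × Bool)) (e : Y × Bool) (l : ℤ), IsLevelPath lev wt l (e :: J) l' →
      (∀ x ∈ e :: J, x.1 ∈ Set.range δ) → FreeGroup.IsReduced (e :: J) →
      ∃ n : ℕ, l' = l + cond e.2 a (-a) * (n + 1) := by
    intro J
    induction J with
    | nil =>
      rintro ⟨y, b⟩ l ⟨rfl, h⟩ hδ -
      obtain ⟨i, hi⟩ := hδ _ (List.mem_singleton_self _)
      simp only at hi
      subst hi
      refine ⟨0, ?_⟩
      rw [← show levelTarget lev wt (δ i, b) = l' from h]
      cases b <;> simp [levelSource, levelTarget, hlev, hwt]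
    | cons e' J ih =>
      rintro e l ⟨rfl, h⟩ hδ hred
      rw [FreeGroup.IsReduced, List.isChain_cons_cons] at hred
      obtain ⟨n, hn⟩ := ih e' _ h (fun x hx => hδ x (List.mem_cons_of_mem _ hx)) hred.2
      obtain ⟨y, b⟩ := e
      obtain ⟨y', b'⟩ := e'
      obtain ⟨i, hi⟩ := hδ (y, b) List.mem_cons_self
      obtain ⟨i', hi'⟩ := hδ (y', b') (List.mem_cons_of_mem _ List.mem_cons_self)
      simp only at hi hi'
      subst hi hi'
      have h1 := h.1
      have h2 : b = b' := by
        cases b <;> cases b' <;> simp [levelSource, levelTarget, hlev, hwt] at h1 hred ⊢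
        · exact hred.1 (by rw [h1])
        · exact hred.1 (by rw [h1])
      subst h2
      refine ⟨n + 1, ?_⟩
      rw [hn]
      cases b <;> simp [levelSource, levelTarget, hlev, hwt] <;> ring
  obtain ⟨e, J, rfl⟩ := List.exists_cons_of_ne_nil hne
  obtain ⟨n, hn⟩ := key J e l hJ hδ hred
  intro hll
  rw [← hll] at hn
  have h1 : cond e.2 a (-a) * ((n : ℤ) + 1) = 0 := by omega
  rcases mul_eq_zero.mp h1 with h2 | h2
  · cases he : e.2 <;> rw [he] at h2 <;> simp at h2 <;> exact ha h2
  · omega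

open Classical in
/-- Delete the letters `δ i` from a word. -/
noncomputable def deleteLetters (δ : ℤ → Y) (L : List (Y × Bool)) : List (Y × Bool) :=
  L.filter fun e => e.1 ∉ Set.range δ

theorem deleteLetters_append (A B : List (Y × Bool)) :
    deleteLetters δ (A ++ B) = deleteLetters δ A ++ deleteLetters δ B := by
  simp [deleteLetters]

theorem mem_deleteLetters {L : List (Y × Bool)} {e : Y × Bool} :
    e ∈ deleteLetters δ L ↔ e ∈ L ∧ e.1 ∉ Set.range δ := by
  simp [deleteLetters]

theorem deleteLetters_eq_nil {L : List (Y × Bool)} :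
    deleteLetters δ L = [] ↔ ∀ e ∈ L, e.1 ∈ Set.range δ := by
  simp [deleteLetters]

theorem IsLevelPath.isReduced_deleteLetters (ha : a ≠ 0) (hlev : ∀ i, lev (δ i) = i)
    (hwt : ∀ i, wt (δ i) = a) {l l' : ℤ} {L : List (Y × Bool)} (hL : IsLevelPath lev wt l L l')
    (hred : FreeGroup.IsReduced L) : FreeGroup.IsReduced (deleteLetters δ L) := by
  classical
  have key : ∀ (L : List (Y × Bool)) (e : Y × Bool) (J : List (Y × Bool)) (l : ℤ),
      e.1 ∉ Set.range δ → (∀ x ∈ J, x.1 ∈ Set.range δ) →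
      IsLevelPath lev wt l (e :: (J ++ L)) l' → FreeGroup.IsReduced (e :: (J ++ L)) →
      FreeGroup.IsReduced (e :: deleteLetters δ L) := by
    intro L
    induction L with
    | nil => intros; simp [deleteLetters, FreeGroup.IsReduced]
    | cons e' L ih =>
      intro e J l he hJ hp hr
      by_cases he' : e'.1 ∈ Set.range δ
      · have h1 : deleteLetters δ (e' :: L) = deleteLetters δ L := by
          simp only [deleteLetters, List.filter_cons]
          rw [if_neg (by simpa using he')]
        rw [h1]
        refine ih e (J ++ [e']) l he ?_ (by simpa using hp) (by simpa using hr)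
        intro x hx
        rcases List.mem_append.mp hx with hx | hx
        · exact hJ x hx
        · rw [List.mem_singleton.mp hx]; exact he'
      · have h1 : deleteLetters δ (e' :: L) = e' :: deleteLetters δ L := by
          simp only [deleteLetters, List.filter_cons]
          rw [if_pos (by simpa using he')]
        rw [h1, FreeGroup.IsReduced, List.isChain_cons_cons]
        obtain ⟨rfl, hp⟩ := hp
        obtain ⟨m, hpJ, hpL⟩ := isLevelPath_append.mp hp
        have hr' : FreeGroup.IsReduced (e' :: L) := hr.of_append_append (e :: J) [] (by simp)
        refine ⟨fun hee => ?_, ih e' [] m he' (by simp) hpL hr'⟩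
        by_contra hb
        have hJ0 : J = [] := by
          by_contra hJne
          refine hpJ.ne_of_forall_mem_range ha hlev hwt hJ
            (hr.of_append_append [e] (e' :: L) (by simp)) hJne ?_
          rw [← hpL.1]
          obtain ⟨y, b⟩ := e
          obtain ⟨y', b'⟩ := e'
          simp only at hee hb
          subst hee
          cases b <;> cases b' <;> simp_all [levelSource, levelTarget]
        subst hJ0
        rw [List.nil_append, FreeGroup.IsReduced, List.isChain_cons_cons] at hr
        exact hb (hr.1 hee)
  induction L generalizing l with
  | nil => simp [deleteLetters, FreeGroup.IsReduced]
  | cons e L ih =>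
    by_cases he : e.1 ∈ Set.range δ
    · have h1 : deleteLetters δ (e :: L) = deleteLetters δ L := by
        simp only [deleteLetters, List.filter_cons]
        rw [if_neg (by simpa using he)]
      rw [h1]
      exact ih hL.2 (hred.of_append_append [e] [] (by simp))
    · have h1 : deleteLetters δ (e :: L) = e :: deleteLetters δ L := by
        simp only [deleteLetters, List.filter_cons]
        rw [if_pos (by simpa using he)]
      rw [h1]
      exact key L e [] l he (by simp) hL hred

/-- If all letters other than the `δ i` are loops at level `m`, then a closed cyclically reduced
path that contains such a letter contains no `δ i`. -/
theorem IsLevelPath.notMem_range_of_loops (ha : a ≠ 0) (hlev : ∀ i, lev (δ i) = i)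
    (hwt : ∀ i, wt (δ i) = a) {l m : ℤ} {L : List (Y × Bool)} (hL : IsLevelPath lev wt l L l)
    (hred : FreeGroup.IsReduced (L ++ L))
    (hloop : ∀ e ∈ L, e.1 ∉ Set.range δ → lev e.1 = m ∧ wt e.1 = 0)
    (hex : ∃ e ∈ L, e.1 ∉ Set.range δ) : ∀ e ∈ L, e.1 ∉ Set.range δ := by
  classical
  have key : ∀ (R : List (Y × Bool)) (J : List (Y × Bool)) (e : Y × Bool) (l' : ℤ),
      e.1 ∉ Set.range δ → lev e.1 = m → wt e.1 = 0 → (∀ x ∈ J, x.1 ∈ Set.range δ) →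
      (∀ x ∈ R, x.1 ∉ Set.range δ → lev x.1 = m ∧ wt x.1 = 0) →
      IsLevelPath lev wt m (J ++ R ++ [e]) l' → FreeGroup.IsReduced (J ++ R ++ [e]) →
      J = [] ∧ ∀ x ∈ R, x.1 ∉ Set.range δ := by
    have hsrc : ∀ e : Y × Bool, lev e.1 = m → wt e.1 = 0 → levelSource lev wt e = m := by
      rintro ⟨y, _ | _⟩ h1 h2 <;> simp_all [levelSource]
    have htgt : ∀ e : Y × Bool, lev e.1 = m → wt e.1 = 0 → levelTarget lev wt e = m := by
      rintro ⟨y, _ | _⟩ h1 h2 <;> simp_all [levelTarget]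
    have hnil : ∀ (J R : List (Y × Bool)) (e : Y × Bool) (l' : ℤ), lev e.1 = m → wt e.1 = 0 →
        (∀ x ∈ J, x.1 ∈ Set.range δ) → IsLevelPath lev wt m (J ++ e :: R) l' →
        FreeGroup.IsReduced (J ++ e :: R) → J = [] := by
      intro J R e l' h1 h2 hJ hp hr
      by_contra hne
      obtain ⟨m', hp1, hp2⟩ := isLevelPath_append.mp hp
      refine hp1.ne_of_forall_mem_range ha hlev hwt hJ (hr.of_append_append [] (e :: R) (by simp)) hne ?_
      rw [← hp2.1, hsrc e h1 h2]
    intro R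
    induction R with
    | nil =>
      intro J e l' he h1 h2 hJ _ hp hr
      rw [List.append_nil] at hp hr
      exact ⟨hnil J [] e l' h1 h2 hJ hp hr, by simp⟩
    | cons x R ih =>
      intro J e l' he h1 h2 hJ hR hp hr
      by_cases hx : x.1 ∈ Set.range δ
      · exfalso
        have := (ih (J ++ [x]) e l' he h1 h2 ?_ (fun z hz => hR z (List.mem_cons_of_mem _ hz))
          (by simpa using hp) (by simpa using hr)).1
        · simp at this
        · intro z hz
          rcases List.mem_append.mp hz with hz | hz
          · exact hJ z hz
          · rw [List.mem_singleton.mp hz]; exact hx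
      · obtain ⟨h3, h4⟩ := hR x List.mem_cons_self hx
        have hJ0 := hnil J (R ++ [e]) x l' h3 h4 hJ (by simpa using hp) (by simpa using hr)
        subst hJ0
        refine ⟨rfl, ?_⟩
        have hp' : IsLevelPath lev wt m ([] ++ R ++ [e]) l' := by
          have := hp.2
          rwa [htgt x h3 h4] at this
        have := (ih [] e l' he h1 h2 (by simp) (fun z hz => hR z (List.mem_cons_of_mem _ hz)) hp'
          (hr.of_append_append [x] [] (by simp))).2
        intro z hz
        rcases List.mem_cons.mp hz with rfl | hz
        · exact hx
        · exact this z hz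
  obtain ⟨e, heL, he⟩ := hex
  obtain ⟨A, C, rfl⟩ := List.append_of_mem heL
  obtain ⟨h1, h2⟩ := hloop e heL he
  obtain ⟨m', hA, hC⟩ := isLevelPath_append.mp hL
  have hm' : m' = m := by
    rw [← hC.1]
    obtain ⟨y, _ | _⟩ := e
    · simp only at h1 h2
      simp only [levelSource, cond_false, h1, h2, add_zero]
    · exact h1
  subst hm'
  have hpath : IsLevelPath lev wt m' (([] : List (Y × Bool)) ++ (e :: C ++ A) ++ [e])
      (levelTarget lev wt e) := by
    rw [List.nil_append, isLevelPath_append]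
    exact ⟨m', isLevelPath_append.mpr ⟨l, hC, hA⟩, hC.1, rfl⟩
  have hmem : ∀ x, x ∈ e :: C ++ A ↔ x ∈ A ++ e :: C := fun x => by
    rw [List.mem_append, List.mem_append, or_comm]
  have := (key (e :: C ++ A) [] e _ he h1 h2 (by simp)
    (fun x hx => hloop x ((hmem x).mp hx)) hpath (hred.of_append_append A C (by simp))).2
  exact fun x hx => this x ((hmem x).mpr hx)

end

/-- The conclusions of the theory of one-relator groups for the relator `FreeGroup.mk c` and its
powers: the Freiheitssatz, the theorem of Weinbaum on subwords, the theorem of Cohen and Lyndon,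
and the order of the root. -/
structure MagnusProperties {X : Type*} (c : List (X × Bool)) : Prop where
  freiheitssatz : ∀ e ∈ c, ∀ u ∈ Subgroup.closure (FreeGroup.of '' {e.1}ᶜ),
    u ∈ Subgroup.normalClosure {FreeGroup.mk c} → u = 1
  subword : SubwordProperty c
  cohenLyndon : ∀ k, CohenLyndon (FreeGroup.mk c) k
  order : ∀ (k : ℕ) (j : ℤ),
    FreeGroup.mk c ^ j ∈ Subgroup.normalClosure {FreeGroup.mk c ^ k} → (k : ℤ) ∣ j

theorem MulEquiv.apply_mem_normalClosure_singleton {G H : Type*} [Group G] [Group H] (α : G ≃* H)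
    {c g : G} : α g ∈ Subgroup.normalClosure {α c} ↔ g ∈ Subgroup.normalClosure {c} := by
  have h := Subgroup.map_normalClosure {c} α.toMonoidHom α.surjective
  have h1 : (α.toMonoidHom : G → H) '' {c} = {α c} := by simp
  rw [h1] at h
  rw [← h]
  exact Subgroup.mem_map_equiv.trans (by simp)

theorem CohenLyndon.map_mulEquiv {G H : Type*} [Group G] [Group H] (α : G ≃* H) {c : G} {k : ℕ}
    (h : CohenLyndon c k) : CohenLyndon (α c) k := by
  obtain ⟨U, hU, hinj⟩ := h
  refine ⟨α '' U, ?_, ?_⟩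
  · have h1 : Subgroup.normalClosure {α c ^ k} =
        (Subgroup.normalClosure {c ^ k}).map α.toMonoidHom := by
      rw [Subgroup.map_normalClosure _ _ α.surjective]
      simp
    rw [h1]
    refine (Subgroup.map_mono hU).trans ?_
    rw [MonoidHom.map_closure, Subgroup.closure_le]
    rintro _ ⟨_, ⟨u, hu, rfl⟩, rfl⟩
    exact Subgroup.subset_closure ⟨α u, ⟨u, hu, rfl⟩, by simp⟩
  · rintro _ ⟨u₁, h₁, rfl⟩ _ ⟨u₂, h₂, rfl⟩ j hj
    rw [← map_pow, ← map_inv, ← map_zpow, ← map_mul, ← map_mul,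
      α.apply_mem_normalClosure_singleton] at hj
    rw [hinj u₁ h₁ u₂ h₂ j hj]

/-- For `a ≠ 0`, a sequence in a group with prescribed quotients of terms at distance `a`. -/
theorem exists_seq_add_eq_mul {K : Type*} [Group K] {a : ℤ} (ha : a ≠ 0) (g : ℤ → K) :
    ∃ T : ℤ → K, T 0 = 1 ∧ ∀ i, T (i + a) = T i * g i := by
  let σ : Equiv.Perm (ℤ × K) :=
    { toFun := fun x => (x.1 + a, x.2 * g x.1)
      invFun := fun x => (x.1 - a, x.2 * (g (x.1 - a))⁻¹)
      left_inv := fun x => by simp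
      right_inv := fun x => by simp }
  have hfst : ∀ (n : ℤ) (x : ℤ × K), ((σ ^ n) x).1 = x.1 + n * a := by
    intro n
    induction n with
    | zero => simp
    | succ n ih =>
      intro x
      rw [zpow_add_one, Equiv.Perm.mul_apply, ih]
      simp only [σ, Equiv.coe_fn_mk]
      ring
    | pred n ih =>
      intro x
      rw [zpow_sub_one, Equiv.Perm.mul_apply, ih]
      have : (σ⁻¹ x).1 = x.1 - a := rfl
      rw [this]
      ring
  refine ⟨fun i => ((σ ^ (i / a)) (i % a, 1)).2, by simp, fun i => ?_⟩
  have h1 : (i + a) / a = i / a + 1 := by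
    simpa using Int.add_mul_ediv_right i 1 ha
  have h2 : (i + a) % a = i % a := Int.add_emod_right i a
  simp only [h1, h2]
  rw [add_comm (i / a), zpow_one_add, Equiv.Perm.mul_apply]
  have h3 := hfst (i / a) (i % a, (1 : K))
  simp only at h3
  rw [Int.emod_add_ediv_mul] at h3
  change (_ * g ((σ ^ (i / a)) (i % a, 1)).1 : K) = _
  rw [h3]

section

variable {Y : Type*} {lev wt : Y → ℤ} {δ : ℤ → Y} {a : ℤ}

/-- An automorphism that straightens the letters `δ i`: up to a factor for either end of a path,
it inserts the letters `δ i` that are missing. -/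
theorem exists_gauge_mulEquiv (ha : a ≠ 0) (hlev : ∀ i, lev (δ i) = i) (hwt : ∀ i, wt (δ i) = a) :
    ∃ (T : ℤ → FreeGroup Y) (α : FreeGroup Y ≃* FreeGroup Y), T 0 = 1 ∧
      (∀ l L l', IsLevelPath lev wt l L l' →
        α (FreeGroup.mk (deleteLetters δ L)) = T l * FreeGroup.mk L * (T l')⁻¹) ∧
      ∀ Z, Set.range δ ⊆ Z → ∀ u ∈ Subgroup.closure (FreeGroup.of '' Z),
        α.symm u ∈ Subgroup.closure (FreeGroup.of '' Z) := by
  classical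
  obtain ⟨T₀, hT₀, hT₀a⟩ := exists_seq_add_eq_mul ha (FreeGroup.of : ℤ → FreeGroup ℤ)
  let T : ℤ → FreeGroup Y := fun i => FreeGroup.map δ (T₀ i)
  have hTa : ∀ i, T (i + a) = T i * FreeGroup.of (δ i) := fun i => by simp [T, hT₀a]
  let α₀ : FreeGroup Y →* FreeGroup Y := FreeGroup.lift fun y =>
    if y ∈ Set.range δ then FreeGroup.of y else T (lev y) * FreeGroup.of y * (T (lev y + wt y))⁻¹
  let β₀ : FreeGroup Y →* FreeGroup Y := FreeGroup.lift fun y =>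
    if y ∈ Set.range δ then FreeGroup.of y else (T (lev y))⁻¹ * FreeGroup.of y * T (lev y + wt y)
  have hα₀ : ∀ i, α₀ (T i) = T i := by
    have : α₀.comp (FreeGroup.map δ) = FreeGroup.map δ := by ext; simp [α₀]
    exact fun i => DFunLike.congr_fun this _
  have hβ₀ : ∀ i, β₀ (T i) = T i := by
    have : β₀.comp (FreeGroup.map δ) = FreeGroup.map δ := by ext; simp [β₀]
    exact fun i => DFunLike.congr_fun this _
  have hαβ : ∀ y, α₀ (β₀ (FreeGroup.of y)) = FreeGroup.of y := by
    intro y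
    by_cases hy : y ∈ Set.range δ
    · simp only [α₀, β₀, FreeGroup.lift_apply_of, if_pos hy]
    · have h1 : β₀ (FreeGroup.of y) = (T (lev y))⁻¹ * FreeGroup.of y * T (lev y + wt y) := by
        simp only [β₀, FreeGroup.lift_apply_of, if_neg hy]
      have h2 : α₀ (FreeGroup.of y) = T (lev y) * FreeGroup.of y * (T (lev y + wt y))⁻¹ := by
        simp only [α₀, FreeGroup.lift_apply_of, if_neg hy]
      rw [h1, map_mul, map_mul, map_inv, hα₀, hα₀, h2]
      group
  have hβα : ∀ y, β₀ (α₀ (FreeGroup.of y)) = FreeGroup.of y := by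
    intro y
    by_cases hy : y ∈ Set.range δ
    · simp only [α₀, β₀, FreeGroup.lift_apply_of, if_pos hy]
    · have h1 : β₀ (FreeGroup.of y) = (T (lev y))⁻¹ * FreeGroup.of y * T (lev y + wt y) := by
        simp only [β₀, FreeGroup.lift_apply_of, if_neg hy]
      have h2 : α₀ (FreeGroup.of y) = T (lev y) * FreeGroup.of y * (T (lev y + wt y))⁻¹ := by
        simp only [α₀, FreeGroup.lift_apply_of, if_neg hy]
      rw [h2, map_mul, map_mul, map_inv, hβ₀, hβ₀, h1]
      group
  let α : FreeGroup Y ≃* FreeGroup Y := MonoidHom.toMulEquiv α₀ β₀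
    (FreeGroup.ext_hom _ _ hβα) (FreeGroup.ext_hom _ _ hαβ)
  refine ⟨T, α, by simp [T, hT₀], fun l L l' hL => ?_, fun Z hZ u hu => ?_⟩
  · have h1 := hL.lift_mk T FreeGroup.of
    rw [FreeGroup.lift_of_eq_id, MonoidHom.id_apply] at h1
    rw [← h1]
    change α₀ (FreeGroup.mk (deleteLetters δ L)) = _
    clear h1 hL
    induction L with
    | nil => rfl
    | cons e L ih =>
      have hcons : ∀ (f : Y → FreeGroup Y), FreeGroup.lift f (FreeGroup.mk (e :: L)) =
          FreeGroup.lift f (FreeGroup.mk [e]) * FreeGroup.lift f (FreeGroup.mk L) := by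
        intro f
        rw [← map_mul, FreeGroup.mul_mk, List.singleton_append]
      rw [hcons, ← ih]
      by_cases he : e.1 ∈ Set.range δ
      · have h2 : deleteLetters δ (e :: L) = deleteLetters δ L := by
          simp only [deleteLetters, List.filter_cons]
          rw [if_neg (by simpa using he)]
        rw [h2]
        obtain ⟨i, hi⟩ := he
        simp [FreeGroup.lift_mk, ← hi, hlev, hwt, hTa, mul_assoc]
      · have h2 : deleteLetters δ (e :: L) = e :: deleteLetters δ L := by
          simp only [deleteLetters, List.filter_cons]
          rw [if_pos (by simpa using he)]
        rw [h2, ← List.singleton_append, ← FreeGroup.mul_mk, map_mul]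
        congr 1
        simp only [α₀, FreeGroup.lift_mk, List.map_cons, List.map_nil, if_neg he]
  · change β₀ u ∈ Subgroup.closure _
    have hT : ∀ i, T i ∈ Subgroup.closure (FreeGroup.of '' Z) := by
      intro i
      have : T i ∈ (FreeGroup.map δ).range := ⟨_, rfl⟩
      rw [FreeGroup.range_map] at this
      refine Subgroup.closure_mono ?_ this
      exact Set.image_mono hZ
    have hle : Subgroup.closure (FreeGroup.of '' Z) ≤
        (Subgroup.closure (FreeGroup.of '' Z)).comap β₀ := by
      rw [Subgroup.closure_le]
      rintro _ ⟨y, hy, rfl⟩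
      have hy' : FreeGroup.of y ∈ Subgroup.closure (FreeGroup.of '' Z) :=
        Subgroup.subset_closure ⟨y, hy, rfl⟩
      rw [SetLike.mem_coe, Subgroup.mem_comap]
      simp only [β₀, FreeGroup.lift_apply_of]
      split_ifs
      · exact hy'
      · exact mul_mem (mul_mem (inv_mem (hT _)) hy') (hT _)
    exact hle hu

/-- The properties of the relator without the letters `δ i` give those of the closed path. -/
theorem MagnusProperties.of_deleteLetters (ha : a ≠ 0) (hlev : ∀ i, lev (δ i) = i)
    (hwt : ∀ i, wt (δ i) = a) {L : List (Y × Bool)} (hL : IsLevelPath lev wt 0 L 0)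
    (hred : FreeGroup.IsReduced (L ++ L)) (h : MagnusProperties (deleteLetters δ L)) :
    (∀ e ∈ L, e.1 ∉ Set.range δ → ∀ u ∈ Subgroup.closure (FreeGroup.of '' {e.1}ᶜ),
      u ∈ Subgroup.normalClosure {FreeGroup.mk L} → u = 1) ∧
    (∀ (A B C : List (Y × Bool)) (l : ℤ), L = A ++ B ++ C → IsLevelPath lev wt l B l → B ≠ [] →
      A ++ C ≠ [] → FreeGroup.mk B ∉ Subgroup.normalClosure {FreeGroup.mk L}) ∧
    (∀ k, CohenLyndon (FreeGroup.mk L) k) ∧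
    ∀ (k : ℕ) (j : ℤ),
      FreeGroup.mk L ^ j ∈ Subgroup.normalClosure {FreeGroup.mk L ^ k} → (k : ℤ) ∣ j := by
  obtain ⟨T, α, hT0, hα, hcl⟩ := exists_gauge_mulEquiv ha hlev hwt
  have hαL : α (FreeGroup.mk (deleteLetters δ L)) = FreeGroup.mk L := by
    rw [hα 0 L 0 hL, hT0]; simp
  refine ⟨fun e he heδ u hu hu' => ?_, fun A B C l hABC hB hB0 hAC hmem => ?_, fun k => ?_,
    fun k j hj => ?_⟩
  · have h1 := h.freiheitssatz e (mem_deleteLetters.mpr ⟨he, heδ⟩) (α.symm u)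
      (hcl _ (by rintro _ ⟨i, rfl⟩ h2; exact heδ ⟨i, h2⟩) u hu)
      (by rw [← α.apply_mem_normalClosure_singleton, hαL]; simpa using hu')
    simpa using h1
  · have hred' : FreeGroup.IsReduced L := hred.of_append_append [] L (by simp)
    have h1 : FreeGroup.mk (deleteLetters δ B) ∈
        Subgroup.normalClosure {FreeGroup.mk (deleteLetters δ L)} := by
      rw [← α.apply_mem_normalClosure_singleton, hαL, hα l B l hB]
      exact Subgroup.normalClosure_normal.conj_mem _ hmem _
    have hdel : deleteLetters δ L = deleteLetters δ A ++ deleteLetters δ B ++ deleteLetters δ C := by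
      rw [hABC, deleteLetters_append, deleteLetters_append]
    have hBne : deleteLetters δ B ≠ [] := fun h0 =>
      hB.ne_of_forall_mem_range ha hlev hwt (deleteLetters_eq_nil.mp h0)
        (hred'.of_append_append A C hABC.symm) hB0 rfl
    refine h.subword _ _ _ hdel hBne (fun h0 => ?_) h1
    obtain ⟨m, hAm, hC⟩ := isLevelPath_append.mp (hABC ▸ hL)
    obtain ⟨m', hA, hB'⟩ := isLevelPath_append.mp hAm
    have hunique : ∀ (D : List (Y × Bool)) (p q r : ℤ), IsLevelPath lev wt p D q →
        IsLevelPath lev wt p D r → q = r := by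
      intro D
      induction D with
      | nil => intro p q r h1 h2; exact Eq.trans (Eq.symm h1) h2
      | cons e D ih => intro p q r h1 h2; exact ih _ _ _ h1.2 h2.2
    obtain rfl : m' = l := by
      obtain ⟨b, B, rfl⟩ := List.exists_cons_of_ne_nil hB0
      exact hB'.1.symm.trans hB.1
    obtain rfl := hunique _ _ _ _ hB hB'
    refine (isLevelPath_append.mpr ⟨0, hC, hA⟩).ne_of_forall_mem_range ha hlev hwt (fun e he => ?_)
      (hred.of_append_append (A ++ B) (B ++ C) (by simp [hABC])) (fun h2 => hAC ?_) rfl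
    · rw [← deleteLetters_append, deleteLetters_eq_nil] at h0
      refine h0 e ?_
      rw [List.mem_append] at he ⊢
      exact he.symm
    · simp only [List.append_eq_nil_iff] at h2 ⊢
      exact h2.symm
  · rw [← hαL]
    exact (h.cohenLyndon k).map_mulEquiv α
  · refine h.order k j ?_
    rw [← hαL, ← map_zpow, ← map_pow, α.apply_mem_normalClosure_singleton] at hj
    exact hj

end

section

variable {X : Type*}

/-- The letters `(z, i)`, with the levels of the letter `p` confined to an interval. -/
abbrev LevelLetter (X : Type*) (p : X) (m M : ℤ) : Type _ :=
  {e : X × ℤ // e.1 = p → m ≤ e.2 ∧ e.2 ≤ M}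

/-- The homomorphism that sends the letter `(z, i)` to the conjugate by the `i`-th power of the
new letter of `z`, corrected so as to have weight zero. -/
def unfoldLevel (φ : X → ℤ) (p : X) (m M : ℤ) :
    FreeGroup (LevelLetter X p m M) →* FreeGroup (Option X) :=
  FreeGroup.lift fun e => FreeGroup.of none ^ e.1.2 * FreeGroup.of (some e.1.1) *
    (FreeGroup.of none ^ (e.1.2 + φ e.1.1))⁻¹

theorem unfoldLevel_mk {φ : X → ℤ} {p : X} {m M : ℤ} {l l' : ℤ}
    {L : List (LevelLetter X p m M × Bool)}
    (hL : IsLevelPath (fun e => e.1.2) (fun e => φ e.1.1) l L l') :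
    unfoldLevel φ p m M (FreeGroup.mk L) = FreeGroup.of none ^ l *
      FreeGroup.map some (FreeGroup.mk (L.map (Prod.map (fun e => e.1.1) id))) *
      (FreeGroup.of none ^ l')⁻¹ := by
  have h := hL.lift_mk (fun i => (FreeGroup.of none : FreeGroup (Option X)) ^ i)
    (fun e => FreeGroup.of (some e.1.1))
  rw [unfoldLevel, h]
  congr 2
  have h1 : FreeGroup.mk (L.map (Prod.map (fun e => e.1.1) id)) =
      FreeGroup.map (fun e : LevelLetter X p m M => e.1.1) (FreeGroup.mk L) := rfl
  have h2 : FreeGroup.lift (fun e : LevelLetter X p m M => FreeGroup.of (some e.1.1)) =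
      (FreeGroup.map some).comp (FreeGroup.map fun e => e.1.1) := by ext; simp
  rw [h1, h2]
  rfl

/-- The description of a one-relator group as an HNN extension of a one-relator group, for the
relator `unfoldLevel φ p m M w` and its powers. -/
theorem unfoldLevel_hnnExtension {φ : X → ℤ} {p : X} {m M : ℤ} (hmM : m ≤ M)
    (w : FreeGroup (LevelLetter X p m M))
    (hA : ∀ u ∈ Subgroup.closure (FreeGroup.of '' {e : LevelLetter X p m M | e.1 ≠ (p, M)}),
      u ∈ Subgroup.normalClosure {w} → u = 1)
    (hB : ∀ u ∈ Subgroup.closure (FreeGroup.of '' {e : LevelLetter X p m M | e.1 ≠ (p, m)}),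
      u ∈ Subgroup.normalClosure {w} → u = 1) (k : ℕ) :
    (∀ g, unfoldLevel φ p m M g ∈ Subgroup.normalClosure {unfoldLevel φ p m M w ^ k} →
      g ∈ Subgroup.normalClosure {w ^ k}) ∧
    (CohenLyndon w k → CohenLyndon (unfoldLevel φ p m M w) k) := by
  set ι := unfoldLevel φ p m M with hι
  let D := {e : LevelLetter X p m M // e.1.1 = p → e.1.2 < M}
  let sh : D → LevelLetter X p m M := fun e => ⟨(e.1.1.1, e.1.1.2 + 1), fun h => by
    have h1 := e.1.2 h
    have h2 := e.2 h
    exact ⟨by simp only; omega, by simp only; omega⟩⟩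
  let a : FreeGroup D →* FreeGroup (LevelLetter X p m M) := FreeGroup.map Subtype.val
  let b : FreeGroup D →* FreeGroup (LevelLetter X p m M) := FreeGroup.map sh
  have ha : Function.Injective a := FreeGroup.map_injective Subtype.val_injective
  have hb : Function.Injective b := by
    refine FreeGroup.map_injective fun e e' h => ?_
    have h1 := congrArg (fun x : LevelLetter X p m M => x.1) h
    simp only [sh, Prod.mk.injEq, add_left_inj] at h1
    exact Subtype.ext (Subtype.ext (Prod.ext h1.1 h1.2))
  set N := Subgroup.normalClosure {w ^ k} with hN
  have hNle : N ≤ Subgroup.normalClosure {w} :=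
    Subgroup.normalClosure_le_normal (Set.singleton_subset_iff.mpr
      (pow_mem (Subgroup.subset_normalClosure (Set.mem_singleton _)) k))
  let π := QuotientGroup.mk' N
  have hinj : ∀ (f : D → LevelLetter X p m M) (q : ℤ), Function.Injective (FreeGroup.map f) →
      (∀ e, (f e).1 ≠ (p, q)) →
      (∀ u ∈ Subgroup.closure (FreeGroup.of '' {e : LevelLetter X p m M | e.1 ≠ (p, q)}),
        u ∈ Subgroup.normalClosure {w} → u = 1) →
      Function.Injective (π.comp (FreeGroup.map f)) := by
    intro f q hf hfq hFS
    rw [injective_iff_map_eq_one]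
    intro u hu
    have h1 : FreeGroup.map f u ∈ N := (QuotientGroup.eq_one_iff _).mp hu
    have h2 : FreeGroup.map f u ∈ (FreeGroup.map f).range := ⟨u, rfl⟩
    rw [FreeGroup.range_map] at h2
    have h3 := hFS _ (Subgroup.closure_mono (Set.image_mono (by
      rintro _ ⟨e, rfl⟩; exact hfq e)) h2) (hNle h1)
    exact (map_eq_one_iff _ hf).mp h3
  have hπa : Function.Injective (π.comp a) := hinj _ M ha (fun e h => by
    have h1 := e.2 (congrArg Prod.fst h)
    have h2 := congrArg Prod.snd h
    simp only at h2
    omega) hA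
  have hπb : Function.Injective (π.comp b) := hinj _ m hb (fun e h => by
    have h1 := (e.1.2 (congrArg Prod.fst h)).1
    have h2 := congrArg Prod.snd h
    simp only [sh] at h2
    omega) hB
  let Φ : (π.comp a).range ≃* (π.comp b).range :=
    (MonoidHom.ofInjective hπa).symm.trans (MonoidHom.ofInjective hπb)
  let t : HNNExtension _ _ _ Φ := HNNExtension.t
  let of' : FreeGroup (LevelLetter X p m M) →* HNNExtension _ _ _ Φ := HNNExtension.of.comp π
  have hrel : ∀ d : FreeGroup D, t * of' (a d) = of' (b d) * t := by
    intro d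
    have h := HNNExtension.t_mul_of (φ := Φ) (MonoidHom.ofInjective hπa d)
    simp only [Φ, MulEquiv.trans_apply, MulEquiv.symm_apply_apply,
      MonoidHom.ofInjective_apply] at h
    exact h
  have hstep : ∀ (z : X) (i : ℤ) (h₁ : z = p → m ≤ i ∧ i ≤ M) (h₂ : z = p → m ≤ i + 1 ∧ i + 1 ≤ M),
      t * of' (FreeGroup.of ⟨(z, i), h₁⟩) = of' (FreeGroup.of ⟨(z, i + 1), h₂⟩) * t := by
    intro z i h₁ h₂
    have h := hrel (FreeGroup.of ⟨⟨(z, i), h₁⟩, fun h => by have := h₂ h; simp only; omega⟩)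
    simpa [a, b, sh] using h
  have hm : ∀ z : X, z = p → m ≤ m ∧ m ≤ M := fun _ _ => ⟨le_rfl, hmM⟩
  have hlevel : ∀ (z : X) (n : ℤ) (h : z = p → m ≤ m + n ∧ m + n ≤ M),
      t ^ n * of' (FreeGroup.of ⟨(z, m), hm z⟩) = of' (FreeGroup.of ⟨(z, m + n), h⟩) * t ^ n := by
    intro z n
    induction n with
    | zero => intro h; simp
    | succ n ih =>
      intro h
      have h' : z = p → m ≤ m + (n : ℤ) ∧ m + (n : ℤ) ≤ M := fun hz => by
        have := h hz; omega
      have h'' : z = p → m ≤ m + (n : ℤ) + 1 ∧ m + (n : ℤ) + 1 ≤ M := fun hz => by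
        have := h hz; omega
      have h3 := hstep z _ h' h''
      have h4 : t ^ ((n : ℤ) + 1) = t * t ^ (n : ℤ) := by rw [add_comm, zpow_one_add]
      rw [h4, mul_assoc, ih h', ← mul_assoc, h3, mul_assoc]
      simp only [add_assoc]
    | pred n ih =>
      intro h
      have hz : z ≠ p := fun hz => by have := h hz; omega
      have h3 := hstep z (m + (-(n : ℤ) - 1)) (fun h => absurd h hz) (fun h => absurd h hz)
      have h4 := ih (fun h => absurd h hz)
      have h5 : m + (-(n : ℤ) - 1) + 1 = m + -(n : ℤ) := by ring
      simp only [h5] at h3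
      have h6 : t ^ (-(n : ℤ) - 1) = t⁻¹ * t ^ (-(n : ℤ)) := by
        rw [sub_eq_neg_add, zpow_add, zpow_neg_one]
      rw [h6, mul_assoc, h4, inv_mul_eq_iff_eq_mul, ← mul_assoc, ← mul_assoc, h3,
        mul_inv_cancel_right]
  let Ψ : FreeGroup (Option X) →* HNNExtension _ _ _ Φ := FreeGroup.lift fun o => o.elim t
    fun z => (t ^ m)⁻¹ * of' (FreeGroup.of ⟨(z, m), hm z⟩) * t ^ (m + φ z)
  have hΨs : Ψ (FreeGroup.of none) = t := by simp [Ψ]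
  have hΨι : ∀ g, Ψ (ι g) = of' g := by
    have : Ψ.comp ι = of' := by
      ext ⟨⟨z, i⟩, h⟩
      have h1 := hlevel z (i - m) (by simpa using h)
      have h2 : m + (i - m) = i := by ring
      simp only [h2] at h1
      simp only [MonoidHom.comp_apply, hι, unfoldLevel, FreeGroup.lift_apply_of, map_mul,
        map_inv, map_zpow, hΨs]
      have h3 : Ψ (FreeGroup.of (some z)) =
        (t ^ m)⁻¹ * of' (FreeGroup.of ⟨(z, m), hm z⟩) * t ^ (m + φ z) := by simp [Ψ]
      rw [h3]
      have h4 : t ^ i * ((t ^ m)⁻¹ * of' (FreeGroup.of ⟨(z, m), hm z⟩) * t ^ (m + φ z)) *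
          (t ^ (i + φ z))⁻¹ = (t ^ (i - m) * of' (FreeGroup.of ⟨(z, m), hm z⟩)) *
          (t ^ (i - m))⁻¹ := by group
      rw [h4, h1, mul_inv_cancel_right]
    exact fun g => DFunLike.congr_fun this g
  refine ⟨fun g hg => ?_, fun hcl => ?_⟩
  · have h1 : Subgroup.normalClosure {ι w ^ k} ≤ Ψ.ker := by
      refine Subgroup.normalClosure_le_normal (Set.singleton_subset_iff.mpr ?_)
      change Ψ (ι w ^ k) = 1
      rw [← map_pow ι, hΨι]
      have : π (w ^ k) = 1 :=
        (QuotientGroup.eq_one_iff _).mpr (Subgroup.subset_normalClosure (Set.mem_singleton _))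
      change HNNExtension.of (π (w ^ k)) = 1
      rw [this, map_one]
    have h2 : Ψ (ι g) = 1 := h1 hg
    rw [hΨι] at h2
    have h3 : π g = 1 := HNNExtension.of_injective Φ (h2.trans (map_one _).symm)
    exact (QuotientGroup.eq_one_iff _).mp h3
  · refine CohenLyndon.of_hnnExtension a b (MonoidHom.range_comp _ _).symm
      (MonoidHom.range_comp _ _).symm ι (FreeGroup.of none) (fun d => ?_) ?_ Ψ hΨι hΨs hcl
    · have h1 : (MulAut.conj (FreeGroup.of none)).toMonoidHom.comp (ι.comp a) = ι.comp b := by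
        ext e
        simp only [hι, a, b, sh, unfoldLevel, MonoidHom.comp_apply, FreeGroup.map.of,
          FreeGroup.lift_apply_of, MulEquiv.toMonoidHom_eq_coe, MonoidHom.coe_coe,
          MulAut.conj_apply]
        group
      have h2 : FreeGroup.of none * ι (a d) * (FreeGroup.of none)⁻¹ = ι (b d) :=
        DFunLike.congr_fun h1 d
      rw [← h2, inv_mul_cancel_right]
    · rw [eq_top_iff, ← FreeGroup.closure_range_of, Subgroup.closure_le]
      have hs : (FreeGroup.of none : FreeGroup (Option X)) ∈
          Subgroup.closure (insert (FreeGroup.of none) (Set.range ι)) :=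
        Subgroup.subset_closure (Set.mem_insert _ _)
      rintro _ ⟨_ | z, rfl⟩
      · exact hs
      · have h1 : ι (FreeGroup.of ⟨(z, m), hm z⟩) ∈
            Subgroup.closure (insert (FreeGroup.of none) (Set.range ι)) :=
          Subgroup.subset_closure (Set.mem_insert_of_mem _ ⟨_, rfl⟩)
        have h2 : FreeGroup.of (some z) = (FreeGroup.of none ^ m)⁻¹ *
            ι (FreeGroup.of ⟨(z, m), hm z⟩) * FreeGroup.of none ^ (m + φ z) := by
          simp only [hι, unfoldLevel, FreeGroup.lift_apply_of]
          group
        rw [h2]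
        exact mul_mem (mul_mem (inv_mem (zpow_mem hs _)) h1) (zpow_mem hs _)

end

section

variable {X : Type*}

/-- The total weight of a word. -/
def wordWeight (φ : X → ℤ) (L : List (X × Bool)) : ℤ :=
  (L.map fun e => cond e.2 (φ e.1) (-φ e.1)).sum

theorem wordWeight_cons (φ : X → ℤ) (e : X × Bool) (L : List (X × Bool)) :
    wordWeight φ (e :: L) = cond e.2 (φ e.1) (-φ e.1) + wordWeight φ L := by
  simp [wordWeight]

theorem ofAdd_wordWeight (φ : X → ℤ) (L : List (X × Bool)) :
    FreeGroup.lift (fun x => Multiplicative.ofAdd (φ x)) (FreeGroup.mk L) =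
      Multiplicative.ofAdd (wordWeight φ L) := by
  induction L with
  | nil => rfl
  | cons e L ih =>
    rw [wordWeight_cons, ofAdd_add, ← ih, ← List.singleton_append, ← FreeGroup.mul_mk, map_mul]
    rcases e with ⟨x, _ | _⟩ <;> simp [FreeGroup.lift_mk]

theorem wordWeight_eq_zero_of_mem_normalClosure {φ : X → ℤ} {c L : List (X × Bool)}
    (hc : wordWeight φ c = 0)
    (hL : FreeGroup.mk L ∈ Subgroup.normalClosure {FreeGroup.mk c}) : wordWeight φ L = 0 := by
  have h1 : Subgroup.normalClosure {FreeGroup.mk c} ≤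
      (FreeGroup.lift fun x => Multiplicative.ofAdd (φ x)).ker := by
    refine Subgroup.normalClosure_le_normal (Set.singleton_subset_iff.mpr ?_)
    rw [SetLike.mem_coe, MonoidHom.mem_ker, ofAdd_wordWeight, hc, ofAdd_zero]
  have h2 := h1 hL
  rw [MonoidHom.mem_ker, ofAdd_wordWeight] at h2
  exact ofAdd_eq_one.mp h2

/-- The path that starts at level `l` and spells a given word. -/
def levelLift (φ : X → ℤ) : ℤ → List (X × Bool) → List ((X × ℤ) × Bool)
  | _, [] => []
  | l, (x, true) :: L => ((x, l), true) :: levelLift φ (l + φ x) L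
  | l, (x, false) :: L => ((x, l - φ x), false) :: levelLift φ (l - φ x) L

theorem levelLift_map_fst (φ : X → ℤ) (l : ℤ) (L : List (X × Bool)) :
    (levelLift φ l L).map (Prod.map Prod.fst id) = L := by
  induction L generalizing l with
  | nil => rfl
  | cons e L ih => rcases e with ⟨x, _ | _⟩ <;> simp [levelLift, ih]

theorem levelLift_append (φ : X → ℤ) (l : ℤ) (A B : List (X × Bool)) :
    levelLift φ l (A ++ B) = levelLift φ l A ++ levelLift φ (l + wordWeight φ A) B := by
  induction A generalizing l with
  | nil => simp [levelLift, wordWeight]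
  | cons e A ih =>
    rcases e with ⟨x, _ | _⟩ <;>
      simp [levelLift, ih, wordWeight_cons, add_assoc, sub_eq_add_neg]

theorem isLevelPath_levelLift (φ : X → ℤ) (l : ℤ) (L : List (X × Bool)) :
    IsLevelPath Prod.snd (φ ∘ Prod.fst) l (levelLift φ l L) (l + wordWeight φ L) := by
  induction L generalizing l with
  | nil => simp [levelLift, wordWeight, IsLevelPath]
  | cons e L ih =>
    rcases e with ⟨x, _ | _⟩
    · have := ih (l - φ x)
      simp only [levelLift, IsLevelPath, levelSource, levelTarget, wordWeight_cons]
      simpa [← add_assoc, ← sub_eq_add_neg] using this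
    · have := ih (l + φ x)
      simp only [levelLift, IsLevelPath, levelSource, levelTarget, wordWeight_cons]
      simpa [← add_assoc] using this

theorem mem_levelLift_of_forall_eq_zero {φ : X → ℤ} {l : ℤ} {L : List (X × Bool)}
    (h : ∀ e ∈ L, φ e.1 = 0) : ∀ e ∈ levelLift φ l L, e.1.2 = l := by
  induction L with
  | nil => simp [levelLift]
  | cons e L ih =>
    have h1 := h e List.mem_cons_self
    have h2 := ih fun e he => h e (List.mem_cons_of_mem _ he)
    rcases e with ⟨x, _ | _⟩ <;> simp only at h1 <;> simpa [levelLift, h1] using h2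

theorem fst_mem_of_mem_levelLift {φ : X → ℤ} {l : ℤ} {L : List (X × Bool)} {e : (X × ℤ) × Bool}
    (he : e ∈ levelLift φ l L) : (e.1.1, e.2) ∈ L := by
  rw [← levelLift_map_fst φ l L]
  exact List.mem_map.mpr ⟨e, he, rfl⟩

theorem List.exists_map_subtype_val {Z : Type*} {P : Z → Prop} {L : List (Z × Bool)}
    (h : ∀ e ∈ L, P e.1) : ∃ L' : List ({z // P z} × Bool),
      L'.map (Prod.map Subtype.val id) = L := by
  induction L with
  | nil => exact ⟨[], rfl⟩
  | cons e L ih =>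
    obtain ⟨L', hL'⟩ := ih fun e he => h e (List.mem_cons_of_mem _ he)
    exact ⟨(⟨e.1, h e List.mem_cons_self⟩, e.2) :: L', by simp [hL']⟩

theorem FreeGroup.exists_mk_eq_of_mem_closure {Z : Set X} {u : FreeGroup X}
    (hu : u ∈ Subgroup.closure (FreeGroup.of '' Z)) :
    ∃ L, FreeGroup.mk L = u ∧ ∀ e ∈ L, e.1 ∈ Z := by
  induction hu using Subgroup.closure_induction with
  | mem u hu =>
    obtain ⟨x, hx, rfl⟩ := hu
    exact ⟨[(x, true)], rfl, by simpa using hx⟩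
  | one => exact ⟨[], rfl, by simp⟩
  | mul u v _ _ hu hv =>
    obtain ⟨A, rfl, hA⟩ := hu
    obtain ⟨B, rfl, hB⟩ := hv
    refine ⟨A ++ B, FreeGroup.mul_mk.symm, fun e he => ?_⟩
    rcases List.mem_append.mp he with he | he
    · exact hA e he
    · exact hB e he
  | inv u _ hu =>
    obtain ⟨A, rfl, hA⟩ := hu
    refine ⟨FreeGroup.invRev A, FreeGroup.inv_mk.symm, fun e he => ?_⟩
    simp only [FreeGroup.invRev, List.mem_reverse, List.mem_map] at he
    obtain ⟨e', he', rfl⟩ := he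
    exact hA e' he'

theorem FreeGroup.mk_mem_closure {Z : Set X} {L : List (X × Bool)} (h : ∀ e ∈ L, e.1 ∈ Z) :
    FreeGroup.mk L ∈ Subgroup.closure (FreeGroup.of '' Z) := by
  induction L with
  | nil => exact one_mem _
  | cons e L ih =>
    rw [← List.singleton_append, ← FreeGroup.mul_mk]
    refine mul_mem ?_ (ih fun e he => h e (List.mem_cons_of_mem _ he))
    have h1 : FreeGroup.of e.1 ∈ Subgroup.closure (FreeGroup.of '' Z) :=
      Subgroup.subset_closure ⟨e.1, h e List.mem_cons_self, rfl⟩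
    rcases e with ⟨x, _ | _⟩
    · exact inv_mem h1
    · exact h1

theorem MonoidHom.apply_mem_normalClosure_singleton {G H : Type*} [Group G] [Group H] (f : G →* H)
    {c g : G} (hg : g ∈ Subgroup.normalClosure {c}) : f g ∈ Subgroup.normalClosure {f c} := by
  have h : Subgroup.normalClosure {c} ≤ (Subgroup.normalClosure {f c}).comap f :=
    Subgroup.normalClosure_le_normal (Set.singleton_subset_iff.mpr
      (Subgroup.subset_normalClosure (Set.mem_singleton _)))
  exact h hg

end

/-- The inductive step in the theory of one-relator groups, for a weight that vanishes on the
relator but not on the letter `d` of the relator, and another letter `p`. -/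
theorem magnusProperties_step.{u} {X : Type u} {c : List (X × Bool)}
    (hred : FreeGroup.IsReduced (c ++ c))
    (ih : ∀ (Y : Type u) (v : List (Y × Bool)), v.length < c.length → v ≠ [] →
      FreeGroup.IsReduced (v ++ v) → MagnusProperties v)
    {φ : X → ℤ} (hφ : wordWeight φ c = 0) {d p : X} (hdp : d ≠ p) (hφd : φ d ≠ 0)
    (hd : ∃ e ∈ c, e.1 = d) (hp : ∃ e ∈ c, e.1 = p) :
    SubwordProperty c ∧ (∀ k, CohenLyndon (FreeGroup.mk c) k) ∧
    (∀ (k : ℕ) (j : ℤ),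
      FreeGroup.mk c ^ j ∈ Subgroup.normalClosure {FreeGroup.mk c ^ k} → (k : ℤ) ∣ j) ∧
    (∀ u ∈ Subgroup.closure (FreeGroup.of '' {p}ᶜ),
      u ∈ Subgroup.normalClosure {FreeGroup.mk c} → u = 1) ∧
    ((∀ z ≠ d, φ z = 0) → (∀ e ∈ c, e.1 = d ∨ e.1 = p) →
      ∀ u ∈ Subgroup.closure (FreeGroup.of '' {d}ᶜ),
        u ∈ Subgroup.normalClosure {FreeGroup.mk c} → u = 1) := by
  classical
  obtain ⟨m, M, hbd, ⟨em, hem, hem'⟩, ⟨eM, heM, heM'⟩⟩ : ∃ m M : ℤ,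
      (∀ e ∈ levelLift φ 0 c, e.1.1 = p → m ≤ e.1.2 ∧ e.1.2 ≤ M) ∧
      (∃ e ∈ levelLift φ 0 c, e.1 = (p, m)) ∧ ∃ e ∈ levelLift φ 0 c, e.1 = (p, M) := by
    let S : Set ((X × ℤ) × Bool) := {e | e ∈ levelLift φ 0 c ∧ e.1.1 = p}
    have hfin : S.Finite := (List.finite_toSet (levelLift φ 0 c)).subset fun e he => he.1
    have hne : S.Nonempty := by
      obtain ⟨e, he, hep⟩ := hp
      rw [← levelLift_map_fst φ 0 c] at he
      obtain ⟨e', he', rfl⟩ := List.mem_map.mp he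
      exact ⟨e', he', hep⟩
    obtain ⟨e₁, h₁, h₁'⟩ := Set.exists_min_image S (fun e => e.1.2) hfin hne
    obtain ⟨e₂, h₂, h₂'⟩ := Set.exists_max_image S (fun e => e.1.2) hfin hne
    exact ⟨e₁.1.2, e₂.1.2, fun e he hep => ⟨h₁' e ⟨he, hep⟩, h₂' e ⟨he, hep⟩⟩,
      ⟨e₁, h₁.1, Prod.ext h₁.2 rfl⟩, ⟨e₂, h₂.1, Prod.ext h₂.2 rfl⟩⟩
  have hmM : m ≤ M := by
    have := hbd em hem (by rw [hem'])
    rw [hem'] at this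
    exact this.2
  let pr : LevelLetter X p m M × Bool → (X × ℤ) × Bool := Prod.map Subtype.val id
  obtain ⟨c', hc'⟩ : ∃ c' : List (LevelLetter X p m M × Bool), c'.map pr = levelLift φ 0 c :=
    List.exists_map_subtype_val hbd
  let lev : LevelLetter X p m M → ℤ := fun e => e.1.2
  let wt : LevelLetter X p m M → ℤ := fun e => φ e.1.1
  have hpath : ∀ (l : ℤ) (L : List (X × Bool)) (L' : List (LevelLetter X p m M × Bool)),
      L'.map pr = levelLift φ l L → IsLevelPath lev wt l L' (l + wordWeight φ L) := by
    intro l L L' h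
    have h1 := isLevelPath_levelLift φ l L
    rw [← h, isLevelPath_map] at h1
    exact h1
  have hιmk : ∀ (l : ℤ) (L : List (X × Bool)) (L' : List (LevelLetter X p m M × Bool)),
      L'.map pr = levelLift φ l L → unfoldLevel φ p m M (FreeGroup.mk L') =
        FreeGroup.of none ^ l * FreeGroup.map some (FreeGroup.mk L) *
          (FreeGroup.of none ^ (l + wordWeight φ L))⁻¹ := by
    intro l L L' h
    rw [unfoldLevel_mk (hpath l L L' h)]
    have h1 : L'.map (Prod.map (fun e => e.1.1) id) = L := by
      rw [← levelLift_map_fst φ l L, ← h, List.map_map]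
      rfl
    rw [h1]
  let δ : ℤ → LevelLetter X p m M := fun i => ⟨(d, i), fun h => absurd h hdp⟩
  have hδ : ∀ e : LevelLetter X p m M, e ∈ Set.range δ ↔ e.1.1 = d := by
    intro e
    constructor
    · rintro ⟨i, rfl⟩; rfl
    · intro h; exact ⟨e.1.2, Subtype.ext (Prod.ext h.symm rfl)⟩
  have hlev : ∀ i, lev (δ i) = i := fun _ => rfl
  have hwt : ∀ i, wt (δ i) = φ d := fun _ => rfl
  have hc'path : IsLevelPath lev wt 0 c' 0 := by
    have := hpath 0 c c' hc'
    rwa [hφ, add_zero] at this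
  have hc'red : FreeGroup.IsReduced (c' ++ c') := by
    refine FreeGroup.IsReduced.of_map (f := fun e : LevelLetter X p m M => e.1.1) ?_
    have h1 : c'.map (Prod.map (fun e : LevelLetter X p m M => e.1.1) id) = c := by
      conv_rhs => rw [← levelLift_map_fst φ 0 c, ← hc', List.map_map]
      rfl
    rwa [List.map_append, h1]
  have hlift : ∀ e ∈ levelLift φ 0 c, ∃ e' ∈ c', pr e' = e := by
    intro e he
    rw [← hc'] at he
    exact List.mem_map.mp he
  have hpδ : ∀ (q : ℤ) (e : LevelLetter X p m M × Bool), (pr e).1 = (p, q) →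
      e.1 ∉ Set.range δ := by
    intro q e he h
    rw [hδ] at h
    exact hdp (h.symm.trans (congrArg Prod.fst he))
  obtain ⟨fM, hfM, rfl⟩ := hlift eM heM
  obtain ⟨fm, hfm, rfl⟩ := hlift em hem
  obtain ⟨fd, hfd, hfd'⟩ : ∃ e ∈ c', e.1 ∈ Set.range δ := by
    obtain ⟨e, he, rfl⟩ := hd
    rw [← levelLift_map_fst φ 0 c] at he
    obtain ⟨e', he', rfl⟩ := List.mem_map.mp he
    obtain ⟨e'', he'', rfl⟩ := hlift e' he'
    exact ⟨e'', he'', (hδ _).mpr rfl⟩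
  have hprops : MagnusProperties (deleteLetters δ c') := by
    refine ih _ _ ?_ ?_ ?_
    · have h1 : c.length = c'.length := by
        have h2 := congrArg List.length hc'
        have h3 := congrArg List.length (levelLift_map_fst φ 0 c)
        rw [List.length_map] at h2 h3
        omega
      rw [h1, deleteLetters, List.length_filter_lt_length_iff_exists]
      exact ⟨fd, hfd, by simpa using hfd'⟩
    · exact List.ne_nil_of_mem (mem_deleteLetters.mpr ⟨hfM, hpδ M fM heM'⟩)
    · rw [← deleteLetters_append]
      exact (isLevelPath_append.mpr ⟨0, hc'path, hc'path⟩).isReduced_deleteLetters hφd hlev hwt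
        hc'red
  obtain ⟨hFS, hWB, hCL, hOR⟩ := hprops.of_deleteLetters hφd hlev hwt hc'path hc'red
  have hFS' : ∀ (q : ℤ) (e : LevelLetter X p m M × Bool), e ∈ c' → (pr e).1 = (p, q) →
      ∀ u ∈ Subgroup.closure (FreeGroup.of '' {y : LevelLetter X p m M | y.1 ≠ (p, q)}),
        u ∈ Subgroup.normalClosure {FreeGroup.mk c'} → u = 1 := by
    intro q e he heq u hu
    refine hFS e he (hpδ q e heq) u ?_
    have h1 : {y : LevelLetter X p m M | y.1 ≠ (p, q)} = {e.1}ᶜ := by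
      ext y
      rw [Set.mem_ofPred_eq, Set.mem_compl_singleton_iff, ← heq, Ne, Ne, Subtype.ext_iff]
      rfl
    rwa [← h1]
  have hHNN := unfoldLevel_hnnExtension (φ := φ) hmM (FreeGroup.mk c')
    (hFS' M fM hfM heM') (hFS' m fm hfm hem')
  have hιc : unfoldLevel φ p m M (FreeGroup.mk c') = FreeGroup.map some (FreeGroup.mk c) := by
    rw [hιmk 0 c c' hc', hφ]
    simp
  rw [hιc] at hHNN
  have hone : ∀ (l : ℤ) (L : List (X × Bool)),
      (∀ e ∈ levelLift φ l L, e.1.1 = p → m ≤ e.1.2 ∧ e.1.2 ≤ M) →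
      (∀ e ∈ levelLift φ l L, e.1 ≠ (p, M)) →
      FreeGroup.mk L ∈ Subgroup.normalClosure {FreeGroup.mk c} → FreeGroup.mk L = 1 := by
    intro l L h1 h2 hL
    obtain ⟨L', hL'⟩ : ∃ L' : List (LevelLetter X p m M × Bool), L'.map pr = levelLift φ l L :=
      List.exists_map_subtype_val h1
    have h3 := hιmk l L L' hL'
    rw [wordWeight_eq_zero_of_mem_normalClosure hφ hL, add_zero] at h3
    have h4 : FreeGroup.mk L' ∈ Subgroup.normalClosure {FreeGroup.mk c'} := by
      have := (hHNN 1).1 (FreeGroup.mk L')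
      rw [pow_one, pow_one] at this
      refine this ?_
      rw [h3]
      exact Subgroup.normalClosure_normal.conj_mem _
        ((FreeGroup.map some).apply_mem_normalClosure_singleton hL) _
    have h5 : FreeGroup.mk L' = 1 := by
      refine hFS' M fM hfM heM' _ (FreeGroup.mk_mem_closure fun e he => ?_) h4
      refine h2 (pr e) ?_
      rw [← hL']
      exact List.mem_map_of_mem he
    rw [h5, map_one, eq_comm, mul_inv_eq_one, mul_eq_left] at h3
    exact (map_eq_one_iff _ (FreeGroup.map_injective (Option.some_injective _))).mp h3
  refine ⟨?_, fun k => ?_, fun k j hj => ?_, ?_, ?_⟩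
  · intro A B C hABC hB hAC hmem
    have hB0 := wordWeight_eq_zero_of_mem_normalClosure hφ hmem
    have h1 := hc'
    rw [hABC, levelLift_append, levelLift_append, List.map_eq_append_iff] at h1
    obtain ⟨AB', C', rfl, h2, hC'⟩ := h1
    obtain ⟨A', B', rfl, hA', hB'⟩ := List.map_eq_append_iff.mp h2
    rw [zero_add] at hB'
    have hlen : ∀ (l : ℤ) (L : List (X × Bool)) (L' : List (LevelLetter X p m M × Bool)),
        L'.map pr = levelLift φ l L → L' = [] → L = [] := by
      rintro l L L' h rfl
      rw [← levelLift_map_fst φ l L, ← h]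
      rfl
    refine hWB A' B' C' (wordWeight φ A) rfl ?_ (fun h => hB (hlen _ _ _ hB' h)) (fun h => ?_) ?_
    · have := hpath _ _ _ hB'
      rwa [hB0, add_zero] at this
    · rw [List.append_eq_nil_iff] at h
      exact hAC (by rw [hlen _ _ _ hA' h.1, hlen _ _ _ hC' h.2]; rfl)
    · have := (hHNN 1).1 (FreeGroup.mk B')
      rw [pow_one, pow_one] at this
      refine this ?_
      rw [hιmk _ _ _ hB', hB0, add_zero]
      exact Subgroup.normalClosure_normal.conj_mem _
        ((FreeGroup.map some).apply_mem_normalClosure_singleton hmem) _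
  · exact ((hHNN k).2 (hCL k)).of_map_some
  · refine hOR k j ((hHNN k).1 _ ?_)
    rw [map_zpow, hιc, ← map_zpow, ← map_pow]
    exact (FreeGroup.map some).apply_mem_normalClosure_singleton hj
  · intro u hu huc
    obtain ⟨L, rfl, hL⟩ := FreeGroup.exists_mk_eq_of_mem_closure hu
    exact hone 0 L (fun e he h => absurd h (hL _ (fst_mem_of_mem_levelLift he)))
      (fun e he h => hL _ (fst_mem_of_mem_levelLift he) (congrArg Prod.fst h)) huc
  · intro hφ0 hcd u hu huc
    obtain ⟨L, rfl, hL⟩ := FreeGroup.exists_mk_eq_of_mem_closure hu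
    have hlt : m < M := by
      refine lt_of_le_of_ne hmM fun hmM' => ?_
      refine hc'path.notMem_range_of_loops (m := m) hφd hlev hwt hc'red (fun e he heδ => ?_)
        ⟨fM, hfM, hpδ M fM heM'⟩ fd hfd hfd'
      have h1 : pr e ∈ levelLift φ 0 c := by rw [← hc']; exact List.mem_map_of_mem he
      rw [hδ] at heδ
      have h2 : e.1.1.1 = p := (hcd _ (fst_mem_of_mem_levelLift h1)).resolve_left heδ
      have h3 := hbd _ h1 h2
      rw [← hmM'] at h3
      exact ⟨le_antisymm h3.2 h3.1, hφ0 _ heδ⟩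
    have hlevL := mem_levelLift_of_forall_eq_zero (l := m) fun e he => hφ0 _ (hL e he)
    refine hone m L (fun e he _ => ?_) (fun e he h => ?_) huc
    · rw [hlevL e he]
      exact ⟨le_rfl, hmM⟩
    · have h1 := hlevL e he
      rw [h] at h1
      exact hlt.ne' h1

section

variable {X : Type*}

theorem FreeGroup.IsReduced.exists_eq_replicate {x : X} {L : List (X × Bool)}
    (h : FreeGroup.IsReduced L) (hx : ∀ e ∈ L, e.1 = x) :
    ∃ b, L = List.replicate L.length (x, b) := by
  induction L with
  | nil => exact ⟨true, rfl⟩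
  | cons e L ih =>
    obtain ⟨b, hb⟩ := ih (h.of_append_append [e] [] (by simp)) fun e he => hx e (List.mem_cons_of_mem _ he)
    obtain rfl := hx e List.mem_cons_self
    cases L with
    | nil => exact ⟨e.2, rfl⟩
    | cons e' L =>
      rw [FreeGroup.IsReduced, List.isChain_cons_cons] at h
      rw [List.length_cons, List.replicate_succ, List.cons.injEq] at hb
      have h1 : e.2 = b := by
        rw [h.1 (by rw [hb.1]), hb.1]
      refine ⟨b, ?_⟩
      rw [List.length_cons, List.length_cons, List.replicate_succ, List.replicate_succ, ← hb.2,
        hb.1, ← h1]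

theorem natAbs_wordWeight_of_isReduced {x : X} {L : List (X × Bool)} (h : FreeGroup.IsReduced L)
    (hx : ∀ e ∈ L, e.1 = x) : (wordWeight 1 L).natAbs = L.length := by
  obtain ⟨b, hb⟩ := h.exists_eq_replicate hx
  rw [hb]
  cases b <;> simp [wordWeight]

theorem wordWeight_dvd_of_mem_normalClosure {φ : X → ℤ} {c L : List (X × Bool)}
    (hL : FreeGroup.mk L ∈ Subgroup.normalClosure {FreeGroup.mk c}) :
    wordWeight φ c ∣ wordWeight φ L := by
  have h := (FreeGroup.lift fun x => Multiplicative.ofAdd (φ x)).apply_mem_normalClosure_singleton hL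
  rw [ofAdd_wordWeight, ofAdd_wordWeight] at h
  have h1 : Subgroup.normalClosure {Multiplicative.ofAdd (wordWeight φ c)} ≤
      Subgroup.zpowers (Multiplicative.ofAdd (wordWeight φ c)) :=
    Subgroup.normalClosure_le_normal (Set.singleton_subset_iff.mpr (Subgroup.mem_zpowers _))
  obtain ⟨n, hn⟩ := Subgroup.mem_zpowers_iff.mp (h1 h)
  refine ⟨n, ?_⟩
  rw [← ofAdd_zsmul] at hn
  rw [mul_comm, ← smul_eq_mul]
  exact (Multiplicative.ofAdd.injective hn).symm

/-- The case of a power of a letter. -/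
theorem magnusProperties_of_forall_eq {x : X} {c : List (X × Bool)} (hc : c ≠ [])
    (hred : FreeGroup.IsReduced c) (hx : ∀ e ∈ c, e.1 = x) : MagnusProperties c := by
  classical
  have hr := natAbs_wordWeight_of_isReduced hred hx
  have hpos := List.length_pos_iff.mpr hc
  refine ⟨fun e he u hu huc => ?_, fun A B C hABC hB hAC hmem => ?_, fun k => ?_, fun k j hj => ?_⟩
  · obtain rfl := hx e he
    let θ : FreeGroup X →* FreeGroup X :=
      FreeGroup.lift fun y => if y = e.1 then 1 else FreeGroup.of y
    have h1 : θ u = u := by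
      refine MonoidHom.eqOn_closure (g := MonoidHom.id _) ?_ hu
      rintro _ ⟨y, hy, rfl⟩
      have hy' : y ≠ e.1 := hy
      simp [θ, hy']
    have h2 := θ.apply_mem_normalClosure_singleton huc
    have h3 : θ (FreeGroup.mk c) = 1 := by
      have h4 := FreeGroup.mk_mem_closure (Z := {e.1}) hx
      have h5 : Subgroup.closure (FreeGroup.of '' {e.1}) ≤ θ.ker := by
        rw [Subgroup.closure_le]
        rintro _ ⟨y, rfl, rfl⟩
        simp [θ, MonoidHom.mem_ker]
      exact h5 h4
    rw [h1, h3] at h2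
    have h4 : Subgroup.normalClosure {(1 : FreeGroup X)} ≤ ⊥ :=
      Subgroup.normalClosure_le_normal (by simp)
    exact h4 h2
  · have h1 := wordWeight_dvd_of_mem_normalClosure (φ := 1) hmem
    rw [← Int.natAbs_dvd_natAbs, hr, natAbs_wordWeight_of_isReduced (hred.of_append_append A C hABC.symm)
      fun e he => hx e (by rw [hABC]; simp [he])] at h1
    have h2 := Nat.le_of_dvd (List.length_pos_iff.mpr hB) h1
    have h3 := List.length_pos_iff.mpr hAC
    have h4 := congrArg List.length hABC
    simp only [List.length_append] at h3 h4
    omega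
  · have h1 := FreeGroup.mk_mem_closure (Z := {x}) hx
    rw [Set.image_singleton, ← Subgroup.zpowers_eq_closure] at h1
    obtain ⟨r, hr⟩ := Subgroup.mem_zpowers_iff.mp h1
    rw [← hr]
    exact cohenLyndon_of_zpow x r k
  · have h1 := (FreeGroup.lift fun _ =>
      Multiplicative.ofAdd (1 : ℤ)).apply_mem_normalClosure_singleton hj
    have h2 := ofAdd_wordWeight 1 c
    simp only [Pi.one_apply] at h2
    rw [map_zpow, map_pow, h2] at h1
    have h3 : Subgroup.normalClosure {Multiplicative.ofAdd (wordWeight 1 c) ^ k} ≤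
        Subgroup.zpowers (Multiplicative.ofAdd (wordWeight 1 c) ^ k) :=
      Subgroup.normalClosure_le_normal (Set.singleton_subset_iff.mpr (Subgroup.mem_zpowers _))
    obtain ⟨n, hn⟩ := Subgroup.mem_zpowers_iff.mp (h3 h1)
    rw [← ofAdd_nsmul, ← ofAdd_zsmul, ← ofAdd_zsmul] at hn
    have h4 := Multiplicative.ofAdd.injective hn
    simp only [smul_eq_mul, nsmul_eq_mul] at h4
    refine ⟨n, ?_⟩
    have h5 : wordWeight 1 c ≠ 0 := by omega
    refine mul_right_cancel₀ h5 ?_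
    linarith

theorem wordWeight_single_sub_single [DecidableEq X] (a b : ℤ) (y z : X) (c : List (X × Bool)) :
    wordWeight (Pi.single y a - Pi.single z b) c =
      a * wordWeight (Pi.single y 1) c - b * wordWeight (Pi.single z 1) c := by
  induction c with
  | nil => simp [wordWeight]
  | cons e c ih =>
    rw [wordWeight_cons, wordWeight_cons, wordWeight_cons, ih]
    rcases e with ⟨x, _ | _⟩ <;>
      simp only [Pi.sub_apply, Pi.single_apply, cond_true, cond_false] <;> split_ifs <;> ring

end

theorem magnusProperties.{u} (n : ℕ) : ∀ (X : Type u) (c : List (X × Bool)), c.length = n →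
    c ≠ [] → FreeGroup.IsReduced (c ++ c) → MagnusProperties c := by
  induction n using Nat.strong_induction_on with
  | _ n ih =>
  intro X c hn hc hred
  classical
  have ih' : ∀ (Y : Type u) (v : List (Y × Bool)), v.length < c.length → v ≠ [] →
      FreeGroup.IsReduced (v ++ v) → MagnusProperties v :=
    fun Y v hv => ih v.length (hn ▸ hv) Y v rfl
  obtain ⟨e₀, he₀⟩ := List.exists_mem_of_ne_nil c hc
  by_cases hall : ∀ e ∈ c, e.1 = e₀.1
  · exact magnusProperties_of_forall_eq hc (hred.of_append_append [] c (by simp)) hall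
  push Not at hall
  obtain ⟨e₁, he₁, hne⟩ := hall
  suffices h : ∀ e ∈ c, SubwordProperty c ∧ (∀ k, CohenLyndon (FreeGroup.mk c) k) ∧
      (∀ (k : ℕ) (j : ℤ), FreeGroup.mk c ^ j ∈ Subgroup.normalClosure {FreeGroup.mk c ^ k} →
        (k : ℤ) ∣ j) ∧
      ∀ u ∈ Subgroup.closure (FreeGroup.of '' {e.1}ᶜ),
        u ∈ Subgroup.normalClosure {FreeGroup.mk c} → u = 1 from
    ⟨fun e he => (h e he).2.2.2, (h e₀ he₀).1, (h e₀ he₀).2.1, (h e₀ he₀).2.2.1⟩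
  intro e he
  obtain ⟨f, hf, hfe⟩ : ∃ f ∈ c, f.1 ≠ e.1 := by
    by_cases h : e₀.1 = e.1
    · exact ⟨e₁, he₁, fun h' => hne (h'.trans h.symm)⟩
    · exact ⟨e₀, he₀, h⟩
  have key : ∀ (φ : X → ℤ) (g : X × Bool), g ∈ c → wordWeight φ c = 0 → φ g.1 ≠ 0 → g.1 ≠ e.1 →
      _ := fun φ g hg hφ hφd hge =>
    let h := magnusProperties_step hred ih' hφ hge hφd ⟨g, hg, rfl⟩ ⟨e, he, rfl⟩
    (⟨h.1, h.2.1, h.2.2.1, h.2.2.2.1⟩ : SubwordProperty c ∧ _ ∧ _ ∧ _)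
  by_cases h₀ : wordWeight (Pi.single e.1 1) c = 0
  · by_cases h₁ : ∃ g ∈ c, g.1 ≠ e.1 ∧ wordWeight (Pi.single g.1 1) c = 0
    · obtain ⟨g, hg, hge, hg0⟩ := h₁
      exact key _ g hg hg0 (by simp) hge
    by_cases h₂ : ∃ g ∈ c, g.1 ≠ e.1 ∧ g.1 ≠ f.1
    · obtain ⟨g, hg, hge, hgf⟩ := h₂
      refine key (Pi.single f.1 (wordWeight (Pi.single g.1 1) c) -
        Pi.single g.1 (wordWeight (Pi.single f.1 1) c)) f hf ?_ ?_ hfe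
      · rw [wordWeight_single_sub_single]; ring
      · have h3 : wordWeight (Pi.single g.1 1) c ≠ 0 := fun h => h₁ ⟨g, hg, hge, h⟩
        simpa [Pi.single_apply, hgf.symm] using h3
    · have h := magnusProperties_step hred ih' h₀ hfe.symm (by simp) ⟨e, he, rfl⟩ ⟨f, hf, rfl⟩
      refine ⟨h.1, h.2.1, h.2.2.1, h.2.2.2.2 (fun z hz => by simp [hz]) fun g hg => ?_⟩
      by_contra hcon
      push Not at hcon
      exact h₂ ⟨g, hg, hcon⟩
  · refine key (Pi.single f.1 (wordWeight (Pi.single e.1 1) c) -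
      Pi.single e.1 (wordWeight (Pi.single f.1 1) c)) f hf ?_ ?_ hfe
    · rw [wordWeight_single_sub_single]; ring
    · simpa [Pi.single_apply, hfe] using h₀

theorem Subgroup.normalClosure_singleton_conj {G : Type*} [Group G] (g x : G) :
    Subgroup.normalClosure {g * x * g⁻¹} = Subgroup.normalClosure {x} := by
  refine le_antisymm (Subgroup.normalClosure_le_normal ?_) (Subgroup.normalClosure_le_normal ?_)
  · exact Set.singleton_subset_iff.mpr (Subgroup.normalClosure_normal.conj_mem _
      (Subgroup.subset_normalClosure (Set.mem_singleton _)) g)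
  · have := Subgroup.normalClosure_normal.conj_mem _
      (Subgroup.subset_normalClosure (Set.mem_singleton (g * x * g⁻¹))) g⁻¹
    refine Set.singleton_subset_iff.mpr ?_
    simpa [mul_assoc] using this

theorem FreeGroup.exists_cyclicallyReduced_conj {S : Type*} {w : FreeGroup S} (hw : w ≠ 1) :
    ∃ (l : List (S × Bool)) (g : FreeGroup S), l ≠ [] ∧ FreeGroup.IsReduced (l ++ l) ∧
      w = g * FreeGroup.mk l * g⁻¹ := by
  classical
  have h1 : FreeGroup.IsCyclicallyReduced (FreeGroup.reduceCyclically w.toWord) :=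
    FreeGroup.reduceCyclically.isCyclicallyReduced (FreeGroup.isReduced_toWord)
  have h2 : w = FreeGroup.mk (FreeGroup.reduceCyclically.conjugator w.toWord) *
      FreeGroup.mk (FreeGroup.reduceCyclically w.toWord) *
      (FreeGroup.mk (FreeGroup.reduceCyclically.conjugator w.toWord))⁻¹ := by
    rw [FreeGroup.inv_mk, FreeGroup.mul_mk, FreeGroup.mul_mk,
      FreeGroup.reduceCyclically.conj_conjugator_reduceCyclically, FreeGroup.mk_toWord]
  refine ⟨_, _, fun h => hw ?_, ?_, h2⟩
  · rw [h2, h, ← FreeGroup.one_eq_mk, mul_one, mul_inv_cancel]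
  · have := (h1.flatten_replicate 2).1
    simpa using this

/-- If `w ∈ F` is not a proper power, `n ≥ 2`, and `F/⟪w⟫` is residually
ℚ-solvable, then `F/⟪wⁿ⟫` is residually solvable. -/
theorem residually_solvable_torsion {S : Type*} (w : FreeGroup S)
    (hnp : ¬ ∃ (v : FreeGroup S) (m : ℕ), 2 ≤ m ∧ w = v ^ m)
    (n : ℕ) (hn : 2 ≤ n)
    (h : ResiduallyQSolvable (FreeGroup S ⧸ Subgroup.normalClosure {w})) :
    (⨅ i : ℕ, derivedSeries (FreeGroup S ⧸ Subgroup.normalClosure {w ^ n}) i) = ⊥ := by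
  have hw : w ≠ 1 := fun hw => hnp ⟨1, 2, le_rfl, by rw [hw, one_pow]⟩
  obtain ⟨l, g, hl, hred, rfl⟩ := FreeGroup.exists_cyclicallyReduced_conj hw
  have hprops := magnusProperties l.length S l rfl hl hred
  have hres : ∀ (N N' : Subgroup (FreeGroup S)) [N.Normal] [N'.Normal], N = N' →
      ResiduallyQSolvable (FreeGroup S ⧸ N) → ResiduallyQSolvable (FreeGroup S ⧸ N') := by
    rintro N _ _ _ rfl
    exact id
  have h' := hres _ _ (Subgroup.normalClosure_singleton_conj g (FreeGroup.mk l)) h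
  rw [eq_bot_iff]
  intro x hx
  obtain ⟨y, rfl⟩ := QuotientGroup.mk'_surjective _ x
  rw [Subgroup.mem_bot]
  refine (QuotientGroup.eq_one_iff y).mpr ?_
  by_contra hy
  rw [Subgroup.mem_iInf] at hx
  have hN : Subgroup.normalClosure {(g * FreeGroup.mk l * g⁻¹) ^ n} =
      Subgroup.normalClosure {FreeGroup.mk l ^ n} := by
    rw [conj_pow, Subgroup.normalClosure_singleton_conj]
  rw [hN] at hy
  obtain ⟨d, hd⟩ := exists_notMem_derivedSeries_sup hl hred hprops.subword hprops.cohenLyndon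
    hprops.order h' (by omega : n ≠ 0) y hy
  apply hd
  have h1 := hx d
  rw [← map_derivedSeries_eq (QuotientGroup.mk'_surjective _) d, ← Subgroup.mem_comap,
    Subgroup.comap_map_eq, QuotientGroup.ker_mk', hN] at h1
  exact h1
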